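/- (Multiple q-Pfaff–Saalschütz sum, Theorem 6.6 of the paper) For all compositions u, w ∈ ℕ^n, Σ_v ((a)_v/(c)_v) ⟦u, v⟧(a, b) ⟦v, w⟧(b, c) = ((a)_w (b)_u / ((b)_w (c)_u)) ⟦u, w⟧(a, c), where the sum is over all compositions v ∈ ℕ^n (it is finitely supported, on |w| ≤ |v| ≤ |u|). -/

import Mathlib

open scoped BigOperators
open MvPolynomial

noncomputable section
namespace LRW

variable {n : ℕ}

/-- `|u|`, the weight of a composition `u ∈ ℕⁿ`. -/
def wt (u : Fin n → ℕ) : ℕ := ∑ i, u i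

/-- `l'_u(i) = #{k > i : u_k > u_i} + #{k < i : u_k ≥ u_i}`. -/
def lp (u : Fin n → ℕ) (i : Fin n) : ℕ :=
  (Finset.univ.filter fun k => i < k ∧ u i < u k).card +
  (Finset.univ.filter fun k => k < i ∧ u i ≤ u k).card

/-- The spectral vector `⟨u⟩ : ⟨u⟩_i = q^{u_i} t^{n−1−l'_u(i)}`. -/
def spec (q t : ℂ) (u : Fin n → ℕ) : Fin n → ℂ :=
  fun i => q ^ u i * t ^ (n - 1 - lp u i)

/-- Leg length `l(s)` of the cell `s = (i, j+1)` of `u` (so `j` ranges over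
`0, …, u_i − 1`): `l(s) = #{k > i : j+1 ≤ u_k ≤ u_i} + #{k < i : j+1 ≤ u_k + 1 ≤ u_i}`. -/
def leg (u : Fin n → ℕ) (i : Fin n) (j : ℕ) : ℕ :=
  (Finset.univ.filter fun k => i < k ∧ j < u k ∧ u k ≤ u i).card +
  (Finset.univ.filter fun k => k < i ∧ j ≤ u k ∧ u k < u i).card

/-- `n(u) = Σ_{s ∈ u} l(s)`. -/
def nstat (u : Fin n → ℕ) : ℕ := ∑ i, ∑ j ∈ Finset.range (u i), leg u i j

/-- `n'(u) = Σ_i C(u_i, 2)`. -/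
def nstat' (u : Fin n → ℕ) : ℕ := ∑ i, Nat.choose (u i) 2

/-- `n(u⁺) = Σ_{i<j} min(u_i, u_j)`, the statistic `n` of the decreasing
rearrangement of `u`. -/
def nplus (u : Fin n → ℕ) : ℕ := ∑ i, ∑ j, if i < j then min (u i) (u j) else 0

/-- `τ_u = (−1)^{|u|} q^{n'(u)} t^{−n(u⁺)}`. -/
def tau (q t : ℂ) (u : Fin n → ℕ) : ℂ := (-1) ^ wt u * q ^ nstat' u / t ^ nplus u

/-- The generalized q-shifted factorial `(z)_u = ∏_{s ∈ u} (1 − z q^{a'(s)} t^{−l'(s)})`. -/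
def qfac (q t z : ℂ) (u : Fin n → ℕ) : ℂ :=
  ∏ i, ∏ j ∈ Finset.range (u i), (1 - z * q ^ j / t ^ lp u i)

/-- `c'_u = ∏_{s ∈ u} (1 − q^{a(s)+1} t^{l(s)})`. -/
def cp (q t : ℂ) (u : Fin n → ℕ) : ℂ :=
  ∏ i, ∏ j ∈ Finset.range (u i), (1 - q ^ (u i - j) * t ^ leg u i j)

/-- `M` is a family of interpolation Macdonald polynomials: `M u` has total degree
at most `|u|`, the coefficient of `x^u` in `M u` is `q^{−n'(u)}`, and `M u`
vanishes at `⟨v⟩` for every `v` with `|v| ≤ |u|`, `v ≠ u`. -/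
def IsInterpFamily (q t : ℂ) (M : (Fin n → ℕ) → MvPolynomial (Fin n) ℂ) : Prop :=
  ∀ u, (M u).totalDegree ≤ wt u ∧
    coeff (Finsupp.equivFunOnFinite.symm u) (M u) = (q ^ nstat' u)⁻¹ ∧
    ∀ v, wt v ≤ wt u → v ≠ u → eval (spec q t v) (M u) = 0

/-- `𝖬_u = q^{n'(u)} t^{n(u)} M_u / c'_u`. -/
def MM (q t : ℂ) (M : (Fin n → ℕ) → MvPolynomial (Fin n) ℂ) (u : Fin n → ℕ) :
    MvPolynomial (Fin n) ℂ :=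
  C (q ^ nstat' u * t ^ nstat u / cp q t u) * M u

/-- `𝖤_u = t^{n(u)} E_u / c'_u`, where `E_u` is the homogeneous component of
degree `|u|` of `M_u`. -/
def EE (q t : ℂ) (M : (Fin n → ℕ) → MvPolynomial (Fin n) ℂ) (u : Fin n → ℕ) :
    MvPolynomial (Fin n) ℂ :=
  C (t ^ nstat u / cp q t u) * homogeneousComponent (wt u) (M u)

/-- The generalized q-binomial coefficient `[u; v] = 𝖬_v(⟨u⟩)/𝖬_v(⟨v⟩)`. -/
def qbin (q t : ℂ) (M : (Fin n → ℕ) → MvPolynomial (Fin n) ℂ) (u v : Fin n → ℕ) : ℂ :=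
  eval (spec q t u) (MM q t M v) / eval (spec q t v) (MM q t M v)

/-- `⟨0⟩/a = (t^{n−1}/a, …, t/a, 1/a)`. -/
def spec0div (q t a : ℂ) : Fin n → ℂ := fun i => spec q t (fun _ => 0) i / a

/-- `cc` is the family of connection coefficients `c_{uv}(a,b)`:
`cc u v = 0` unless `|v| ≤ |u|`, and `𝖬_u(a·x) = Σ_v cc u v · 𝖬_v(b·x)`. -/
def IsConnection (q t : ℂ) (M : (Fin n → ℕ) → MvPolynomial (Fin n) ℂ) (a b : ℂ)
    (cc : (Fin n → ℕ) → (Fin n → ℕ) → ℂ) : Prop :=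
  (∀ u v, wt u < wt v → cc u v = 0) ∧
  ∀ u, aeval (fun i => C a * X i) (MM q t M u) =
    ∑ᶠ v, cc u v • aeval (fun i => C b * X i) (MM q t M v)

/-- `⟦u, v⟧(a, b) = (𝖤_v(⟨0⟩/a)/𝖤_u(⟨0⟩/b)) · c_{uv}(a, b)`. -/
def skew (q t : ℂ) (M : (Fin n → ℕ) → MvPolynomial (Fin n) ℂ) (a b : ℂ)
    (cc : (Fin n → ℕ) → (Fin n → ℕ) → ℂ) (u v : Fin n → ℕ) : ℂ :=
  eval (spec0div q t a) (EE q t M v) / eval (spec0div q t b) (EE q t M u) * cc u v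

/-- `(z; q)_∞ = ∏_{m ≥ 0} (1 − z q^m)`. -/
noncomputable def qpochInf (z q : ℂ) : ℂ := ∏' m : ℕ, (1 - z * q ^ m)


section Filtration

/-- Polynomials of total degree less than `d`. -/
def degLT (n d : ℕ) : Submodule ℂ (MvPolynomial (Fin n) ℂ) where
  carrier := {f | ∀ s : Fin n →₀ ℕ, d ≤ s.degree → coeff s f = 0}
  zero_mem' := by intro s _; simp
  add_mem' := by intro f g hf hg s hs; simp [hf s hs, hg s hs]
  smul_mem' := by intro c f hf s hs; simp [hf s hs]

lemma mem_degLT {d : ℕ} {f : MvPolynomial (Fin n) ℂ} :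
    f ∈ degLT n d ↔ ∀ s : Fin n →₀ ℕ, d ≤ s.degree → coeff s f = 0 := Iff.rfl

lemma mem_degLT_succ {d : ℕ} {f : MvPolynomial (Fin n) ℂ} :
    f ∈ degLT n (d + 1) ↔ f.totalDegree ≤ d := by
  rw [mem_degLT, totalDegree_eq, Finset.sup_le_iff]
  constructor
  · intro h s hs
    by_contra hlt
    rw [Finsupp.card_toMultiset] at hlt
    refine mem_support_iff.1 hs (h s ?_)
    rw [Finsupp.degree_eq_sum]
    rw [Finsupp.sum_fintype _ _ (fun _ => rfl)] at hlt
    exact Nat.lt_of_not_le hlt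
  · intro h s hs
    by_contra hne
    have := h s (mem_support_iff.2 hne)
    rw [Finsupp.card_toMultiset, Finsupp.sum_fintype _ _ (fun _ => rfl)] at this
    rw [Finsupp.degree_eq_sum] at hs
    exact absurd (hs.trans this) (Nat.not_succ_le_self d)

lemma eq_zero_of_mem_degLT_zero {f : MvPolynomial (Fin n) ℂ} (h : f ∈ degLT n 0) : f = 0 := by
  ext s
  simpa using h s (Nat.zero_le _)

lemma degLT_mono {d e : ℕ} (hde : d ≤ e) : degLT n d ≤ degLT n e :=
  fun _ hf s hs => hf s (hde.trans hs)

lemma exists_mem_degLT (f : MvPolynomial (Fin n) ℂ) : ∃ d, f ∈ degLT n d :=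
  ⟨f.totalDegree + 1, mem_degLT_succ.2 le_rfl⟩

lemma mul_mem_degLT {d : ℕ} {p f : MvPolynomial (Fin n) ℂ} (hp : p.totalDegree ≤ 1)
    (hf : f ∈ degLT n d) : p * f ∈ degLT n (d + 1) := by
  cases d with
  | zero => simp [eq_zero_of_mem_degLT_zero hf]
  | succ d =>
    rw [mem_degLT_succ] at hf ⊢
    exact (totalDegree_mul p f).trans (by omega)

lemma mem_degLT_of_mul_mem {d : ℕ} {p f : MvPolynomial (Fin n) ℂ} (hp : 1 ≤ p.totalDegree)
    (hf : p * f ∈ degLT n (d + 1)) : f ∈ degLT n d := by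
  by_cases hf0 : f = 0
  · simp [hf0]
  have hp0 : p ≠ 0 := by rintro rfl; simp at hp
  rw [mem_degLT_succ, totalDegree_mul_of_isDomain hp0 hf0] at hf
  cases d with
  | zero => omega
  | succ d => rw [mem_degLT_succ]; omega

lemma aeval_mem_degLT {k d : ℕ} {g : Fin k → MvPolynomial (Fin n) ℂ}
    (hg : ∀ i, (g i).totalDegree ≤ 1) {f : MvPolynomial (Fin k) ℂ} (hf : f ∈ degLT k d) :
    aeval g f ∈ degLT n d := by
  cases d with
  | zero => simp [eq_zero_of_mem_degLT_zero hf]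
  | succ d =>
    rw [mem_degLT_succ] at hf ⊢
    rw [aeval_def, eval₂_eq]
    refine totalDegree_finsetSum_le fun s hs => ?_
    refine (totalDegree_mul _ _).trans ?_
    have h1 : (algebraMap ℂ (MvPolynomial (Fin n) ℂ) (coeff s f)).totalDegree = 0 :=
      totalDegree_C _
    rw [h1, zero_add]
    refine (totalDegree_finsetProd _ _).trans ?_
    refine le_trans ?_ ((le_totalDegree hs).trans hf)
    refine Finset.sum_le_sum fun i _ => (totalDegree_pow _ _).trans ?_
    exact (Nat.mul_le_mul_left _ (hg i)).trans (by simp)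

lemma totalDegree_X_sub_le {i : Fin n} {r : MvPolynomial (Fin n) ℂ} (hr : r.totalDegree ≤ 1) :
    (X i - r).totalDegree ≤ 1 :=
  (totalDegree_sub _ _).trans (by simp [totalDegree_X, hr])

lemma one_le_totalDegree_of_coeff {i : Fin n} {p : MvPolynomial (Fin n) ℂ}
    (h : coeff (Finsupp.single i 1) p ≠ 0) : 1 ≤ p.totalDegree := by
  simpa using le_totalDegree (mem_support_iff.2 h)

lemma one_le_totalDegree_X_sub_C (i : Fin n) (c : ℂ) : 1 ≤ (X i - C c).totalDegree := by
  refine one_le_totalDegree_of_coeff (i := i) ?_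
  have : (0 : Fin n →₀ ℕ) ≠ Finsupp.single i 1 := (Finsupp.single_ne_zero.2 one_ne_zero).symm
  simp [coeff_X, coeff_C, this]

lemma one_le_totalDegree_X_sub_X {i j : Fin n} (hij : i ≠ j) :
    1 ≤ (X i - X j : MvPolynomial (Fin n) ℂ).totalDegree := by
  refine one_le_totalDegree_of_coeff (i := i) ?_
  simp [coeff_X, Finsupp.single_left_inj, hij.symm]

/-- The factor theorem for the linear polynomial `X j - r`. -/
lemma X_sub_dvd {j : Fin n} {r f : MvPolynomial (Fin n) ℂ}
    (h : ∀ x : Fin n → ℂ, eval (Function.update x j (eval x r)) f = 0) : X j - r ∣ f := by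
  have h0 : aeval (Function.update X j r) f = 0 := by
    refine MvPolynomial.funext fun x => ?_
    rw [map_zero, ← h x, ← coe_aeval_eq_eval, ← coe_aeval_eq_eval]
    simp only [RingHom.coe_coe]
    rw [← AlgHom.comp_apply]
    congr 1
    ext i
    by_cases hi : i = j
    · subst hi; simp
    · simp [hi]
  rw [← Ideal.mem_span_singleton, ← Ideal.Quotient.eq_zero_iff_mem]
  rw [← map_zero (Ideal.Quotient.mk (Ideal.span {X j - r})), ← h0]
  have : (Ideal.Quotient.mkₐ ℂ (Ideal.span {X j - r})) =
      (Ideal.Quotient.mkₐ ℂ (Ideal.span {X j - r})).comp (aeval (Function.update X j r)) := by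
    ext i
    by_cases hi : i = j
    · subst hi
      simp only [Ideal.Quotient.mkₐ_eq_mk, AlgHom.comp_apply, aeval_X, Function.update_self]
      rw [Ideal.Quotient.eq]
      exact Ideal.mem_span_singleton_self _
    · simp [hi]
  exact congrArg (fun φ => φ f) this

/-- Division of a linear operator by a polynomial. -/
lemma exists_linear_div {k : ℕ} {p : MvPolynomial (Fin n) ℂ} (hp : p ≠ 0)
    (L : MvPolynomial (Fin k) ℂ →ₗ[ℂ] MvPolynomial (Fin n) ℂ) (hL : ∀ f, p ∣ L f) :
    ∃ G : MvPolynomial (Fin k) ℂ →ₗ[ℂ] MvPolynomial (Fin n) ℂ, ∀ f, p * G f = L f := by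
  choose g hg using hL
  refine ⟨{ toFun := g, map_add' := fun x y => ?_, map_smul' := fun c x => ?_ },
    fun f => (hg f).symm⟩
  · apply mul_left_cancel₀ hp
    rw [mul_add, ← hg, ← hg, ← hg, map_add]
  · apply mul_left_cancel₀ hp
    rw [RingHom.id_apply, mul_smul_comm, ← hg, ← hg, map_smul]

/-- The scaling operator `f(x) ↦ f(s·x)`. -/
def scale (s : ℂ) : MvPolynomial (Fin n) ℂ →ₐ[ℂ] MvPolynomial (Fin n) ℂ :=
  aeval fun i => C s * X i

lemma eval_scale (s : ℂ) (x : Fin n → ℂ) (f : MvPolynomial (Fin n) ℂ) :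
    eval x (scale s f) = eval (fun i => s * x i) f := by
  rw [← coe_aeval_eq_eval, ← coe_aeval_eq_eval]
  simp only [RingHom.coe_coe, scale]
  rw [← AlgHom.comp_apply]
  congr 1
  ext i
  simp

lemma scale_scale (s r : ℂ) (f : MvPolynomial (Fin n) ℂ) :
    scale s (scale r f) = scale (s * r) f := by
  refine MvPolynomial.funext fun x => ?_
  simp only [eval_scale]
  congr 2
  ext i
  ring_nf

lemma scale_one (f : MvPolynomial (Fin n) ℂ) : scale 1 f = f := by
  refine MvPolynomial.funext fun x => ?_
  simp [eval_scale]

lemma totalDegree_C_mul_X_le (s : ℂ) (i : Fin n) :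
    (C s * X i : MvPolynomial (Fin n) ℂ).totalDegree ≤ 1 :=
  (totalDegree_mul _ _).trans (by simp [totalDegree_X])

lemma coeff_scale (s : ℂ) (f : MvPolynomial (Fin n) ℂ) (e : Fin n →₀ ℕ) :
    coeff e (scale s f) = s ^ e.degree * coeff e f := by
  induction f using MvPolynomial.induction_on' with
  | add p q hp hq => simp [hp, hq, mul_add]
  | monomial u a =>
    have : scale s (monomial u a) = C (s ^ u.degree) * monomial u a := by
      rw [scale, aeval_monomial, Finsupp.prod_fintype _ _ (fun _ => pow_zero _)]
      simp only [mul_pow, Finset.prod_mul_distrib, ← C_pow, ← map_prod, Finset.prod_pow_eq_pow_sum,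
        ← Finsupp.degree_eq_sum]
      rw [monomial_eq, Finsupp.prod_fintype _ _ (fun _ => pow_zero _), algebraMap_eq]
      ring
    rw [this, coeff_C_mul, coeff_monomial]
    split_ifs with h
    · rw [h]
    · simp

lemma scale_sub_mem_degLT (s : ℂ) {d : ℕ} {f : MvPolynomial (Fin n) ℂ}
    (hf : f ∈ degLT n (d + 1)) : scale s f - s ^ d • f ∈ degLT n d := by
  intro e he
  rw [coeff_sub, coeff_scale, coeff_smul, smul_eq_mul]
  rcases he.eq_or_lt with h | h
  · rw [h, sub_self]
  · rw [hf e h]; simp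

end Filtration

section Combinatorics

/-- The parameters `q, t` are nonzero and multiplicatively independent. -/
structure Generic (q t : ℂ) : Prop where
  q_ne : q ≠ 0
  t_ne : t ≠ 0
  indep : ∀ i j : ℤ, ¬(i = 0 ∧ j = 0) → q ^ i * t ^ j ≠ 1

lemma lp_eq_card (u : Fin n → ℕ) (i : Fin n) :
    lp u i = (Finset.univ.filter fun k => u i < u k ∨ (u i = u k ∧ k < i)).card := by
  rw [lp, ← Finset.card_union_of_disjoint]
  · congr 1
    ext k
    simp only [Finset.mem_union, Finset.mem_filter, Finset.mem_univ, true_and]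
    rcases lt_trichotomy i k with h | h | h
    · simp [h, h.not_gt]
    · simp [h]
    · simp [h, h.not_gt, le_iff_lt_or_eq]
  · rw [Finset.disjoint_filter]
    rintro k - ⟨h, -⟩ ⟨h', -⟩
    exact absurd h h'.not_gt

lemma lp_lt (u : Fin n → ℕ) (i : Fin n) : lp u i < n := by
  rw [lp_eq_card]
  have : (Finset.univ.filter fun k => u i < u k ∨ (u i = u k ∧ k < i)) ⊂ Finset.univ := by
    rw [Finset.ssubset_univ_iff]
    intro h
    have := Finset.mem_univ i
    rw [← h] at this
    simp at this
  simpa using Finset.card_lt_card this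

variable {m : ℕ}

lemma spec_eq_div {q t : ℂ} (ht : t ≠ 0) (u : Fin (m + 1) → ℕ) (i : Fin (m + 1)) :
    spec q t u i = q ^ u i * (t ^ m / t ^ lp u i) := by
  rw [spec, Nat.add_sub_cancel, pow_sub₀ t ht (Nat.lt_succ_iff.1 (lp_lt u i)), div_eq_mul_inv]

lemma spec_ne_zero {q t : ℂ} (h : Generic q t) (u : Fin n → ℕ) (i : Fin n) :
    spec q t u i ≠ 0 :=
  mul_ne_zero (pow_ne_zero _ h.q_ne) (pow_ne_zero _ h.t_ne)

lemma Generic.mul_ne_mul {q t : ℂ} (h : Generic q t) {a b c d : ℕ} (hne : a ≠ b ∨ c ≠ d) :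
    q ^ a * t ^ c ≠ q ^ b * t ^ d := by
  intro heq
  refine h.indep ((a : ℤ) - b) ((c : ℤ) - d) (by omega) ?_
  have hq := h.q_ne
  have ht := h.t_ne
  rw [zpow_sub₀ hq, zpow_sub₀ ht, zpow_natCast, zpow_natCast, zpow_natCast, zpow_natCast]
  field_simp
  exact heq

/-- The raising operation `(w_1, …, w_n) ↦ (w_2, …, w_n, w_1 + 1)`. -/
def raise (w : Fin (m + 1) → ℕ) : Fin (m + 1) → ℕ :=
  Fin.snoc (α := fun _ => ℕ) (fun i : Fin m => w i.succ) (w 0 + 1)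

@[simp] lemma raise_castSucc (w : Fin (m + 1) → ℕ) (i : Fin m) :
    raise w i.castSucc = w i.succ := by simp [raise]

@[simp] lemma raise_last (w : Fin (m + 1) → ℕ) : raise w (Fin.last m) = w 0 + 1 := by
  simp [raise]

lemma raise_injective : Function.Injective (raise (m := m)) := by
  intro v w h
  funext i
  refine Fin.cases ?_ (fun i => ?_) i
  · simpa using congrFun h (Fin.last m)
  · simpa using congrFun h i.castSucc

lemma exists_raise {v : Fin (m + 1) → ℕ} (hv : v (Fin.last m) ≠ 0) : ∃ w, v = raise w := by
  refine ⟨Fin.cons (v (Fin.last m) - 1) fun i => v i.castSucc, ?_⟩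
  funext i
  refine Fin.lastCases ?_ (fun i => ?_) i
  · simp; omega
  · simp

lemma wt_raise (w : Fin (m + 1) → ℕ) : wt (raise w) = wt w + 1 := by
  rw [wt, wt, Fin.sum_univ_castSucc, Fin.sum_univ_succ]
  simp
  ring

lemma lp_raise_castSucc (w : Fin (m + 1) → ℕ) (i : Fin m) :
    lp (raise w) i.castSucc = lp w i.succ := by
  rw [lp_eq_card, lp_eq_card, Finset.card_filter, Finset.card_filter, Fin.sum_univ_castSucc,
    Fin.sum_univ_succ, add_comm]
  simp [le_iff_lt_or_eq, not_lt.2 (Fin.le_last _)]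

lemma lp_raise_last (w : Fin (m + 1) → ℕ) : lp (raise w) (Fin.last m) = lp w 0 := by
  rw [lp_eq_card, lp_eq_card, Finset.card_filter, Finset.card_filter, Fin.sum_univ_castSucc,
    Fin.sum_univ_succ, add_comm]
  simp only [raise_last, raise_castSucc, lt_irrefl, and_false, or_false, if_false, Fin.not_lt_zero]
  congr 1
  refine Finset.sum_congr rfl fun i _ => ?_
  refine if_congr ?_ rfl rfl
  simp only [Fin.castSucc_lt_last, and_true]
  omega

/-- The cyclic shift `(x_1, …, x_n) ↦ (x_2, …, x_n, q x_1)` of points. -/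
def shiftPt (q : ℂ) (x : Fin (m + 1) → ℂ) : Fin (m + 1) → ℂ :=
  Fin.snoc (α := fun _ => ℂ) (fun i : Fin m => x i.succ) (q * x 0)

@[simp] lemma shiftPt_castSucc (q : ℂ) (x : Fin (m + 1) → ℂ) (i : Fin m) :
    shiftPt q x i.castSucc = x i.succ := by simp [shiftPt]

@[simp] lemma shiftPt_last (q : ℂ) (x : Fin (m + 1) → ℂ) :
    shiftPt q x (Fin.last m) = q * x 0 := by simp [shiftPt]

lemma spec_raise (q t : ℂ) (w : Fin (m + 1) → ℕ) :
    spec q t (raise w) = shiftPt q (spec q t w) := by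
  funext i
  refine Fin.lastCases ?_ (fun i => ?_) i
  · simp [spec, lp_raise_last, pow_succ]; ring
  · simp [spec, lp_raise_castSucc]

/-- The adjacent transposition `(i, i+1)`. -/
def adj (i : Fin m) : Equiv.Perm (Fin (m + 1)) := Equiv.swap i.castSucc i.succ

lemma adj_lt_iff (i : Fin m) {j k : Fin (m + 1)} (h : ¬(j = i.castSucc ∧ k = i.succ))
    (h' : ¬(j = i.succ ∧ k = i.castSucc)) : adj i j < adj i k ↔ j < k := by
  simp only [adj, Equiv.swap_apply_def]
  simp only [Fin.ext_iff, Fin.val_castSucc, Fin.val_succ] at h h'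
  split_ifs with h1 h2 h3 h4 h5 h6 h7 h8 <;>
    simp only [Fin.ext_iff, Fin.lt_def, Fin.val_castSucc, Fin.val_succ] at * <;> omega

lemma lp_adj (w : Fin (m + 1) → ℕ) (i : Fin m) (hw : w i.castSucc ≠ w i.succ)
    (k : Fin (m + 1)) : lp (w ∘ adj i) k = lp w (adj i k) := by
  rw [lp_eq_card, lp_eq_card]
  refine Finset.card_equiv (adj i) fun j => ?_
  simp only [Finset.mem_filter, Finset.mem_univ, true_and, Function.comp]
  refine or_congr Iff.rfl (and_congr_right fun heq => ?_)
  refine (adj_lt_iff i ?_ ?_).symm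
  · rintro ⟨rfl, rfl⟩
    simp [adj] at heq
    exact hw heq
  · rintro ⟨rfl, rfl⟩
    simp [adj] at heq
    exact hw heq.symm

lemma comp_adj_of_eq (w : Fin (m + 1) → ℕ) (i : Fin m) (hw : w i.castSucc = w i.succ) :
    w ∘ adj i = w := by
  funext k
  simp only [Function.comp, adj, Equiv.swap_apply_def]
  split_ifs with h1 h2
  · rw [h1, hw]
  · rw [h2, hw]
  · rfl

lemma lp_succ_of_eq (w : Fin (m + 1) → ℕ) (i : Fin m) (hw : w i.castSucc = w i.succ) :
    lp w i.succ = lp w i.castSucc + 1 := by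
  rw [lp_eq_card, lp_eq_card, ← Finset.card_insert_of_notMem (a := i.castSucc) (by simp)]
  congr 1
  ext k
  simp only [Finset.mem_filter, Finset.mem_univ, true_and, Finset.mem_insert, hw]
  have : k < i.succ ↔ k = i.castSucc ∨ k < i.castSucc := by
    simp only [Fin.ext_iff, Fin.lt_def, Fin.val_castSucc, Fin.val_succ]; omega
  rw [this]
  constructor
  · rintro (h | ⟨h, h' | h'⟩)
    · exact Or.inr (Or.inl h)
    · exact Or.inl h'
    · exact Or.inr (Or.inr ⟨h, h'⟩)
  · rintro (h | h | ⟨h, h'⟩)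
    · exact Or.inr ⟨by rw [h, hw], Or.inl h⟩
    · exact Or.inl h
    · exact Or.inr ⟨h, Or.inr h'⟩

lemma spec_adj (q t : ℂ) (w : Fin (m + 1) → ℕ) (i : Fin m) (hw : w i.castSucc ≠ w i.succ) :
    spec q t (w ∘ adj i) = spec q t w ∘ adj i := by
  funext k
  simp [spec, lp_adj w i hw]

lemma spec_castSucc_of_eq {q t : ℂ} (ht : t ≠ 0) (w : Fin (m + 1) → ℕ) (i : Fin m)
    (hw : w i.castSucc = w i.succ) : spec q t w i.castSucc = t * spec q t w i.succ := by
  rw [spec_eq_div ht, spec_eq_div ht, lp_succ_of_eq w i hw, hw, pow_succ]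
  field_simp

lemma spec_castSucc_ne {q t : ℂ} (h : Generic q t) (w : Fin (m + 1) → ℕ) (i : Fin m) :
    spec q t w i.castSucc ≠ spec q t w i.succ := by
  refine h.mul_ne_mul ?_
  by_cases hw : w i.castSucc = w i.succ
  · right
    have := lp_succ_of_eq w i hw
    have := lp_lt w i.succ
    omega
  · exact Or.inl hw

lemma spec_castSucc_ne_mul {q t : ℂ} (h : Generic q t) (w : Fin (m + 1) → ℕ) (i : Fin m)
    (hw : w i.castSucc ≠ w i.succ) : spec q t w i.castSucc ≠ t * spec q t w i.succ := by
  have := h.mul_ne_mul (c := m + 1 - 1 - lp w i.castSucc) (d := m + 1 - 1 - lp w i.succ + 1)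
    (Or.inl hw)
  intro heq
  apply this
  simp only [spec] at heq
  rw [heq]
  ring

lemma qfac_adj (q t z : ℂ) (w : Fin (m + 1) → ℕ) (i : Fin m) :
    qfac q t z (w ∘ adj i) = qfac q t z w := by
  by_cases hw : w i.castSucc = w i.succ
  · rw [comp_adj_of_eq w i hw]
  · rw [qfac, qfac, ← Equiv.prod_comp (adj i)
      (fun k => ∏ j ∈ Finset.range (w k), (1 - z * q ^ j / t ^ lp w k))]
    simp only [lp_adj w i hw, Function.comp]

lemma wt_comp_perm (w : Fin n → ℕ) (e : Equiv.Perm (Fin n)) : wt (w ∘ e) = wt w :=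
  Equiv.sum_comp e w

lemma qfac_raise {q t : ℂ} (ht : t ≠ 0) (z : ℂ) (w : Fin (m + 1) → ℕ) :
    qfac q t z (raise w) = qfac q t z w * (1 - z * (spec q t w 0 / t ^ m)) := by
  rw [qfac, qfac, Fin.prod_univ_castSucc, Fin.prod_univ_succ]
  simp only [raise_castSucc, raise_last, lp_raise_castSucc, lp_raise_last,
    Finset.prod_range_succ, spec_eq_div ht]
  have : z * (q ^ w 0 * (t ^ m / t ^ lp w 0) / t ^ m) = z * q ^ w 0 / t ^ lp w 0 := by
    field_simp
  rw [this]
  ring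

/-- Compositions with the same weight and the same generalized `q`-shifted factorials. -/
def Similar (q t : ℂ) (v w : Fin n → ℕ) : Prop :=
  wt v = wt w ∧ ∀ z, qfac q t z v = qfac q t z w

lemma Similar.refl (q t : ℂ) (v : Fin n → ℕ) : Similar q t v v := ⟨rfl, fun _ => rfl⟩

lemma Similar.symm {q t : ℂ} {v w : Fin n → ℕ} (h : Similar q t v w) : Similar q t w v :=
  ⟨h.1.symm, fun z => (h.2 z).symm⟩

lemma Similar.trans {q t : ℂ} {u v w : Fin n → ℕ} (h : Similar q t u v) (h' : Similar q t v w) :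
    Similar q t u w :=
  ⟨h.1.trans h'.1, fun z => (h.2 z).trans (h'.2 z)⟩

lemma similar_adj (q t : ℂ) (w : Fin (m + 1) → ℕ) (i : Fin m) : Similar q t (w ∘ adj i) w :=
  ⟨wt_comp_perm _ _, fun z => qfac_adj q t z w i⟩

end Combinatorics

section Interpolation

variable {m : ℕ}

/-- The inverse of `shiftPt`. -/
def unshiftPt (q : ℂ) (x : Fin (m + 1) → ℂ) : Fin (m + 1) → ℂ :=
  Fin.cons (q⁻¹ * x (Fin.last m)) fun i => x i.castSucc

lemma shiftPt_unshiftPt {q : ℂ} (hq : q ≠ 0) (x : Fin (m + 1) → ℂ) :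
    shiftPt q (unshiftPt q x) = x := by
  funext i
  refine Fin.lastCases ?_ (fun i => ?_) i
  · simp [unshiftPt, hq]
  · simp [unshiftPt]

lemma unshiftPt_shiftPt {q : ℂ} (hq : q ≠ 0) (x : Fin (m + 1) → ℂ) :
    unshiftPt q (shiftPt q x) = x := by
  funext i
  refine Fin.cases ?_ (fun i => ?_) i
  · simp [unshiftPt, hq]
  · simp [unshiftPt]

lemma eval_aeval {k : ℕ} (g : Fin k → MvPolynomial (Fin n) ℂ) (x : Fin n → ℂ)
    (f : MvPolynomial (Fin k) ℂ) : eval x (aeval g f) = eval (fun i => eval x (g i)) f := by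
  induction f using MvPolynomial.induction_on with
  | C a => simp
  | add p r hp hr => rw [map_add, map_add, hp, hr, map_add]
  | mul_X p i hp => rw [map_mul, map_mul, hp, aeval_X, map_mul, eval_X]

/-- The operator `f(x) ↦ f(x_2, …, x_n, q x_1)`. -/
def shift (q : ℂ) : MvPolynomial (Fin (m + 1)) ℂ →ₐ[ℂ] MvPolynomial (Fin (m + 1)) ℂ :=
  aeval (Fin.snoc (α := fun _ => MvPolynomial (Fin (m + 1)) ℂ) (fun i : Fin m => X i.succ)
    (C q * X 0))

/-- The operator `f(x) ↦ f(x_n / q, x_1, …, x_{n-1})`. -/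
def unshift (q : ℂ) : MvPolynomial (Fin (m + 1)) ℂ →ₐ[ℂ] MvPolynomial (Fin (m + 1)) ℂ :=
  aeval (Fin.cons (C q⁻¹ * X (Fin.last m)) fun i => X i.castSucc :
    Fin (m + 1) → MvPolynomial (Fin (m + 1)) ℂ)

lemma eval_shift (q : ℂ) (x : Fin (m + 1) → ℂ) (f : MvPolynomial (Fin (m + 1)) ℂ) :
    eval x (shift q f) = eval (shiftPt q x) f := by
  rw [shift, eval_aeval]
  congr 2
  funext i
  refine Fin.lastCases ?_ (fun i => ?_) i <;> simp

lemma eval_unshift (q : ℂ) (x : Fin (m + 1) → ℂ) (f : MvPolynomial (Fin (m + 1)) ℂ) :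
    eval x (unshift q f) = eval (unshiftPt q x) f := by
  rw [unshift, eval_aeval]
  congr 2
  funext i
  refine Fin.cases ?_ (fun i => ?_) i <;> simp [unshiftPt]

lemma shift_mem_degLT (q : ℂ) {d : ℕ} {f : MvPolynomial (Fin (m + 1)) ℂ}
    (hf : f ∈ degLT (m + 1) d) : shift q f ∈ degLT (m + 1) d := by
  refine aeval_mem_degLT (fun i => ?_) hf
  refine Fin.lastCases ?_ (fun i => ?_) i
  · rw [Fin.snoc_last]; exact totalDegree_C_mul_X_le _ _
  · rw [Fin.snoc_castSucc, totalDegree_X]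

lemma unshift_mem_degLT (q : ℂ) {d : ℕ} {f : MvPolynomial (Fin (m + 1)) ℂ}
    (hf : f ∈ degLT (m + 1) d) : unshift q f ∈ degLT (m + 1) d := by
  refine aeval_mem_degLT (fun i => ?_) hf
  refine Fin.cases ?_ (fun i => ?_) i
  · rw [Fin.cons_zero]; exact totalDegree_C_mul_X_le _ _
  · rw [Fin.cons_succ, totalDegree_X]

lemma unshift_shift {q : ℂ} (hq : q ≠ 0) (f : MvPolynomial (Fin (m + 1)) ℂ) :
    unshift q (shift q f) = f := by
  refine MvPolynomial.funext fun x => ?_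
  rw [eval_unshift, eval_shift, shiftPt_unshiftPt hq]

lemma lp_snoc_zero_castSucc (v : Fin m → ℕ) (i : Fin m) :
    lp (Fin.snoc (α := fun _ => ℕ) v 0 : Fin (m + 1) → ℕ) i.castSucc = lp v i := by
  rw [lp_eq_card, lp_eq_card, Finset.card_filter, Finset.card_filter, Fin.sum_univ_castSucc]
  simp [Fin.le_last]

lemma lp_snoc_zero_last (v : Fin m → ℕ) :
    lp (Fin.snoc (α := fun _ => ℕ) v 0 : Fin (m + 1) → ℕ) (Fin.last m) = m := by
  rw [lp_eq_card, Finset.card_filter, Fin.sum_univ_castSucc]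
  have : ∀ i : Fin m, 0 < v i ∨ 0 = v i := fun i => by omega
  simp [Fin.castSucc_lt_last, this]

lemma spec_snoc_zero (q t : ℂ) (v : Fin m → ℕ) :
    spec q t (Fin.snoc (α := fun _ => ℕ) v 0 : Fin (m + 1) → ℕ) =
      Fin.snoc (α := fun _ => ℂ) (fun i => t * spec q t v i) 1 := by
  funext i
  refine Fin.lastCases ?_ (fun i => ?_) i
  · simp [spec, lp_snoc_zero_last]
  · simp only [spec, lp_snoc_zero_castSucc, Fin.snoc_castSucc]
    have := lp_lt v i
    rw [show m + 1 - 1 - lp v i = m - 1 - lp v i + 1 by omega, pow_succ]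
    ring

lemma spec_raise_last_ne_one {q t : ℂ} (h : Generic q t) (w : Fin (m + 1) → ℕ) :
    spec q t (raise w) (Fin.last m) ≠ 1 := by
  have := h.mul_ne_mul (a := w 0 + 1) (b := 0) (c := m + 1 - 1 - lp w 0) (d := 0)
    (Or.inl (by omega))
  simpa [spec, lp_raise_last] using this

/-- A polynomial of degree less than `d` vanishing at all `⟨v⟩` with `|v| < d` is zero. -/
theorem eq_zero_of_eval_spec {q t : ℂ} (h : Generic q t) (n : ℕ) : ∀ (d : ℕ)
    (f : MvPolynomial (Fin n) ℂ), f ∈ degLT n d →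
    (∀ v : Fin n → ℕ, wt v < d → eval (spec q t v) f = 0) → f = 0 := by
  induction n with
  | zero =>
    intro d f hf hv
    cases d with
    | zero => exact eq_zero_of_mem_degLT_zero hf
    | succ d =>
      refine MvPolynomial.funext fun x => ?_
      rw [map_zero, ← hv (fun _ => 0) (by simp [wt])]
      congr 2
      exact Subsingleton.elim _ _
  | succ m ihm =>
    intro d
    induction d with
    | zero => exact fun f hf _ => eq_zero_of_mem_degLT_zero hf
    | succ d ihd =>
      intro f hf hv
      have hres : aeval (Fin.snoc (α := fun _ => MvPolynomial (Fin m) ℂ)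
          (fun i : Fin m => C t * X i) 1) f = 0 := by
        refine ihm (d + 1) _ (aeval_mem_degLT (fun i => ?_) hf) fun v hvd => ?_
        · refine Fin.lastCases ?_ (fun i => ?_) i
          · rw [Fin.snoc_last, totalDegree_one]; exact Nat.zero_le _
          · rw [Fin.snoc_castSucc]; exact totalDegree_C_mul_X_le _ _
        · rw [eval_aeval, ← hv (Fin.snoc (α := fun _ => ℕ) v 0), spec_snoc_zero]
          · congr 2
            funext i
            refine Fin.lastCases ?_ (fun i => ?_) i <;> simp
          · simpa [wt, Fin.sum_univ_castSucc] using hvd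
      have hdvd : X (Fin.last m) - C 1 ∣ f := by
        refine X_sub_dvd fun x => ?_
        have := congrArg (eval fun i => t⁻¹ * x i.castSucc) hres
        rw [eval_aeval, map_zero] at this
        rw [← this]
        congr 2
        funext i
        refine Fin.lastCases ?_ (fun i => ?_) i
        · simp
        · simp [h.t_ne, (Fin.castSucc_lt_last i).ne]
      obtain ⟨g, rfl⟩ := hdvd
      have hg : g ∈ degLT (m + 1) d :=
        mem_degLT_of_mul_mem (one_le_totalDegree_X_sub_C _ _) hf
      have hs : shift q g = 0 := by
        refine ihd _ (shift_mem_degLT q hg) fun w hw => ?_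
        have := hv (raise w) (by rw [wt_raise]; omega)
        rw [eval_mul, mul_eq_zero] at this
        rw [eval_shift, ← spec_raise]
        refine this.resolve_left ?_
        simpa [sub_eq_zero] using spec_raise_last_ne_one h w
      have hg0 : g = 0 := by rw [← unshift_shift h.q_ne g, hs, map_zero]
      rw [hg0, mul_zero]

/-- A family of nonzero multiples of the interpolation Macdonald polynomials. -/
structure Interp (q t : ℂ) (B : (Fin n → ℕ) → MvPolynomial (Fin n) ℂ) : Prop where
  mem : ∀ u, B u ∈ degLT n (wt u + 1)
  van : ∀ u v, wt v ≤ wt u → v ≠ u → eval (spec q t v) (B u) = 0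
  diag : ∀ u, eval (spec q t u) (B u) ≠ 0

variable {q t : ℂ} {B : (Fin n → ℕ) → MvPolynomial (Fin n) ℂ}

lemma Interp.mk_of_ne_zero (h : Generic q t) (mem : ∀ u, B u ∈ degLT n (wt u + 1))
    (van : ∀ u v, wt v ≤ wt u → v ≠ u → eval (spec q t v) (B u) = 0) (ne : ∀ u, B u ≠ 0) :
    Interp q t B := by
  refine ⟨mem, van, fun u hu => ne u ?_⟩
  refine eq_zero_of_eval_spec h n (wt u + 1) _ (mem u) fun v hv => ?_
  by_cases hvu : v = u
  · rw [hvu, hu]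
  · exact van u v (Nat.lt_succ_iff.1 hv) hvu

lemma Interp.eval_sum (hB : Interp q t B) (c : (Fin n → ℕ) → ℂ) {d : ℕ} {v : Fin n → ℕ}
    (hv : wt v ≤ d) : eval (spec q t v) (∑ u ∈ Finset.piAntidiag Finset.univ d, c u • B u) =
      if wt v = d then c v * eval (spec q t v) (B v) else 0 := by
  rw [map_sum]
  have hz : ∀ u ∈ Finset.piAntidiag Finset.univ d, v ≠ u →
      eval (spec q t v) (c u • B u) = 0 := by
    intro u hu hne
    have : wt u = d := (Finset.mem_piAntidiag.1 hu).1
    rw [smul_eval, hB.van u v (by omega) hne, mul_zero]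
  split_ifs with h
  · rw [Finset.sum_eq_single v (fun u hu hne => hz u hu hne.symm) (fun hn => ?_), smul_eval]
    exact absurd (Finset.mem_piAntidiag.2 ⟨h, fun i _ => Finset.mem_univ i⟩) hn
  · refine Finset.sum_eq_zero fun u hu => hz u hu ?_
    rintro rfl
    exact h (Finset.mem_piAntidiag.1 hu).1

lemma Interp.sum_mem (hB : Interp q t B) (c : (Fin n → ℕ) → ℂ) (d : ℕ) :
    ∑ u ∈ Finset.piAntidiag Finset.univ d, c u • B u ∈ degLT n (d + 1) := by
  refine Submodule.sum_mem _ fun u hu => Submodule.smul_mem _ _ ?_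
  have : wt u = d := (Finset.mem_piAntidiag.1 hu).1
  exact this ▸ hB.mem u

/-- A polynomial of degree at most `d` vanishing at all `⟨v⟩`, `|v| ≤ d`, except those with
`|v| = d` and `v ∈ T`, is a combination of the `B v` with `|v| = d` and `v ∈ T`. -/
lemma Interp.mem_span_of_vanish (h : Generic q t) (hB : Interp q t B) {d : ℕ}
    (T : Set (Fin n → ℕ)) {f : MvPolynomial (Fin n) ℂ} (hf : f ∈ degLT n (d + 1))
    (hv : ∀ v, wt v ≤ d → ¬(wt v = d ∧ v ∈ T) → eval (spec q t v) f = 0) :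
    f ∈ Submodule.span ℂ (B '' {v | wt v = d ∧ v ∈ T}) := by
  set c : (Fin n → ℕ) → ℂ := fun v => eval (spec q t v) f / eval (spec q t v) (B v) with hc
  have hfc : f = ∑ u ∈ Finset.piAntidiag Finset.univ d, c u • B u := by
    rw [← sub_eq_zero]
    refine eq_zero_of_eval_spec h n (d + 1) _ (Submodule.sub_mem _ hf (hB.sum_mem c d))
      fun v hvd => ?_
    rw [map_sub, hB.eval_sum c (Nat.lt_succ_iff.1 hvd)]
    split_ifs with hw
    · rw [hc, div_mul_cancel₀ _ (hB.diag v), sub_self]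
    · rw [hv v (Nat.lt_succ_iff.1 hvd) (fun hh => hw hh.1), sub_zero]
  rw [hfc]
  refine Submodule.sum_mem _ fun u hu => ?_
  have hud : wt u = d := (Finset.mem_piAntidiag.1 hu).1
  by_cases huT : u ∈ T
  · exact Submodule.smul_mem _ _ (Submodule.subset_span ⟨u, ⟨hud, huT⟩, rfl⟩)
  · have : c u = 0 := by
      simp only [hc]
      rw [hv u hud.le (fun hh => huT hh.2), zero_div]
    rw [this, zero_smul]
    exact Submodule.zero_mem _

lemma Interp.eq_smul_of_vanish (h : Generic q t) (hB : Interp q t B) {u : Fin n → ℕ}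
    {f : MvPolynomial (Fin n) ℂ} (hf : f ∈ degLT n (wt u + 1))
    (hv : ∀ v, wt v ≤ wt u → v ≠ u → eval (spec q t v) f = 0) : ∃ c : ℂ, f = c • B u := by
  have := hB.mem_span_of_vanish h {u} hf fun v hvd hvu => hv v hvd fun he => hvu (by simp [he])
  have hset : {v : Fin n → ℕ | wt v = wt u ∧ v ∈ ({u} : Set _)} = {u} := by
    ext v
    simp only [Set.mem_ofPred_eq, Set.mem_singleton_iff]
    exact ⟨fun hh => hh.2, fun hh => ⟨by rw [hh], hh⟩⟩
  rw [hset, Set.image_singleton, Submodule.mem_span_singleton] at this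
  obtain ⟨c, hc⟩ := this
  exact ⟨c, hc.symm⟩

lemma Interp.degLT_le_span (h : Generic q t) (hB : Interp q t B) (d : ℕ) :
    degLT n d ≤ Submodule.span ℂ (B '' {v | wt v < d}) := by
  have key : ∀ φ : (Fin n → ℕ) → ℂ, ∃ g ∈ Submodule.span ℂ (B '' {v | wt v < d}),
      g ∈ degLT n d ∧ ∀ v, wt v < d → eval (spec q t v) g = φ v := by
    intro φ
    induction d with
    | zero => exact ⟨0, Submodule.zero_mem _, Submodule.zero_mem _, fun v hv => by omega⟩
    | succ d ih =>
      obtain ⟨g, hg, hgd, hgv⟩ := ih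
      refine ⟨g + ∑ u ∈ Finset.piAntidiag Finset.univ d,
        ((φ u - eval (spec q t u) g) / eval (spec q t u) (B u)) • B u,
        Submodule.add_mem _ ?_ (Submodule.sum_mem _ fun u hu => Submodule.smul_mem _ _
          (Submodule.subset_span ⟨u, ?_, rfl⟩)),
        Submodule.add_mem _ (degLT_mono (Nat.le_succ d) hgd) (hB.sum_mem _ d), fun v hv => ?_⟩
      · refine Submodule.span_mono (Set.image_mono fun v (hv : wt v < d) => ?_) hg
        exact hv.trans (Nat.lt_succ_self d)
      · have : wt u = d := (Finset.mem_piAntidiag.1 hu).1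
        exact this ▸ Nat.lt_succ_self _
      · rw [map_add, hB.eval_sum _ (Nat.lt_succ_iff.1 hv)]
        split_ifs with hw
        · rw [div_mul_cancel₀ _ (hB.diag v), add_sub_cancel]
        · rw [add_zero, hgv v (by omega)]
  intro f hf
  obtain ⟨g, hg, hgd, hgv⟩ := key fun v => eval (spec q t v) f
  have : f - g = 0 := eq_zero_of_eval_spec h n d _ (Submodule.sub_mem _ hf hgd) fun v hv => by
    rw [map_sub, hgv v hv, sub_self]
  rwa [sub_eq_zero.1 this]

lemma Interp.linearIndependent (hB : Interp q t B) : LinearIndependent ℂ B := by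
  rw [linearIndependent_iff']
  intro s g hg
  have key : ∀ d, ∀ u ∈ s, wt u = d → g u = 0 := by
    intro d
    induction d using Nat.strong_induction_on with
    | _ d ih =>
      intro u hu hud
      have he := congrArg (eval (spec q t u)) hg
      rw [map_sum, map_zero, Finset.sum_eq_single u, smul_eval, mul_eq_zero] at he
      · exact he.resolve_right (hB.diag u)
      · intro v hv hvu
        rw [smul_eval]
        by_cases hlt : wt v < d
        · rw [ih _ hlt v hv rfl, zero_mul]
        · rw [hB.van v u (by omega) hvu.symm, mul_zero]
      · exact fun hn => absurd hu hn
  exact fun u hu => key _ u hu rfl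

/-- The basis of interpolation polynomials. -/
def Interp.basis (h : Generic q t) (hB : Interp q t B) :
    Module.Basis (Fin n → ℕ) ℂ (MvPolynomial (Fin n) ℂ) :=
  Module.Basis.mk hB.linearIndependent fun f _ => by
    obtain ⟨d, hd⟩ := exists_mem_degLT f
    exact Submodule.span_mono (Set.image_subset_range _ _) (hB.degLT_le_span h d hd)

@[simp] lemma Interp.basis_apply (h : Generic q t) (hB : Interp q t B) (u : Fin n → ℕ) :
    hB.basis h u = B u := by
  rw [Interp.basis, Module.Basis.mk_apply]

/-- The operator which is diagonal in the basis of interpolation polynomials. -/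
def Interp.diagOp (h : Generic q t) (hB : Interp q t B) (φ : (Fin n → ℕ) → ℂ) :
    MvPolynomial (Fin n) ℂ →ₗ[ℂ] MvPolynomial (Fin n) ℂ :=
  (hB.basis h).constr ℂ fun u => φ u • B u

lemma Interp.diagOp_apply (h : Generic q t) (hB : Interp q t B) (φ : (Fin n → ℕ) → ℂ)
    (u : Fin n → ℕ) : hB.diagOp h φ (B u) = φ u • B u := by
  conv_lhs => rw [← hB.basis_apply h u]
  rw [Interp.diagOp, Module.Basis.constr_basis]

lemma Interp.hom_ext (h : Generic q t) (hB : Interp q t B)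
    {L L' : MvPolynomial (Fin n) ℂ →ₗ[ℂ] MvPolynomial (Fin n) ℂ}
    (hL : ∀ u, L (B u) = L' (B u)) : L = L' :=
  (hB.basis h).ext fun u => by rw [hB.basis_apply h, hL]

lemma Interp.map_mem_of_forall (h : Generic q t) (hB : Interp q t B)
    {L : MvPolynomial (Fin n) ℂ →ₗ[ℂ] MvPolynomial (Fin n) ℂ} {d : ℕ}
    {N : Submodule ℂ (MvPolynomial (Fin n) ℂ)} (hL : ∀ u, wt u < d → L (B u) ∈ N)
    {f : MvPolynomial (Fin n) ℂ} (hf : f ∈ degLT n d) : L f ∈ N := by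
  have : Submodule.span ℂ (B '' {v | wt v < d}) ≤ N.comap L := by
    rw [Submodule.span_le]
    rintro _ ⟨u, hu, rfl⟩
    exact hL u hu
  exact this (hB.degLT_le_span h d hf)

end Interpolation

section Hecke

variable {m : ℕ}

lemma X_sub_X_ne_zero (i : Fin m) :
    (X i.castSucc - X i.succ : MvPolynomial (Fin (m + 1)) ℂ) ≠ 0 := by
  intro h
  have := one_le_totalDegree_X_sub_X (Fin.castSucc_lt_succ (i := i)).ne
  simp [h] at this

lemma exists_dividedDifference (i : Fin m) :
    ∃ G : MvPolynomial (Fin (m + 1)) ℂ →ₗ[ℂ] MvPolynomial (Fin (m + 1)) ℂ,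
      ∀ f, (X i.castSucc - X i.succ) * G f = f - rename (adj i) f := by
  refine exists_linear_div (X_sub_X_ne_zero i)
    (LinearMap.id - (rename (R := ℂ) (adj i)).toLinearMap) fun f => ?_
  refine X_sub_dvd fun x => ?_
  simp only [LinearMap.sub_apply, LinearMap.id_apply, AlgHom.toLinearMap_apply, map_sub,
    eval_rename, eval_X]
  rw [sub_eq_zero]
  congr 2
  funext k
  have hne : i.succ ≠ i.castSucc := Fin.castSucc_lt_succ.ne'
  simp only [Function.comp, adj, Equiv.swap_apply_def]
  split_ifs with h1 h2
  · rw [h1]; simp [hne]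
  · rw [h2]; simp [hne]
  · rfl

/-- The divided difference `(f - s_i f) / (x_i - x_{i+1})`. -/
def dividedDifference (i : Fin m) :
    MvPolynomial (Fin (m + 1)) ℂ →ₗ[ℂ] MvPolynomial (Fin (m + 1)) ℂ :=
  (exists_dividedDifference i).choose

lemma mul_dividedDifference (i : Fin m) (f : MvPolynomial (Fin (m + 1)) ℂ) :
    (X i.castSucc - X i.succ) * dividedDifference i f = f - rename (adj i) f :=
  (exists_dividedDifference i).choose_spec f

/-- The Hecke operator `f ↦ s_i f + (1 - t⁻¹) x_i (f - s_i f) / (x_i - x_{i+1})`. -/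
def hecke (t : ℂ) (i : Fin m) :
    MvPolynomial (Fin (m + 1)) ℂ →ₗ[ℂ] MvPolynomial (Fin (m + 1)) ℂ :=
  (rename (R := ℂ) (adj i)).toLinearMap +
    (1 - t⁻¹) • (LinearMap.mulLeft ℂ (X i.castSucc)).comp (dividedDifference i)

lemma hecke_apply (t : ℂ) (i : Fin m) (f : MvPolynomial (Fin (m + 1)) ℂ) :
    hecke t i f = rename (adj i) f + (1 - t⁻¹) • (X i.castSucc * dividedDifference i f) := rfl

lemma rename_mem_degLT (e : Equiv.Perm (Fin n)) {d : ℕ} {f : MvPolynomial (Fin n) ℂ}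
    (hf : f ∈ degLT n d) : rename e f ∈ degLT n d := by
  cases d with
  | zero => simp [eq_zero_of_mem_degLT_zero hf]
  | succ d =>
    rw [mem_degLT_succ] at hf ⊢
    exact (totalDegree_rename_le _ _).trans hf

lemma hecke_mem_degLT (t : ℂ) (i : Fin m) {d : ℕ} {f : MvPolynomial (Fin (m + 1)) ℂ}
    (hf : f ∈ degLT (m + 1) d) : hecke t i f ∈ degLT (m + 1) d := by
  cases d with
  | zero => simp [eq_zero_of_mem_degLT_zero hf]
  | succ d =>
    have hr := rename_mem_degLT (adj i) hf
    refine Submodule.add_mem _ hr (Submodule.smul_mem _ _ ?_)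
    refine mul_mem_degLT (totalDegree_X _).le ?_
    refine mem_degLT_of_mul_mem (one_le_totalDegree_X_sub_X (Fin.castSucc_lt_succ (i := i)).ne) ?_
    rw [mul_dividedDifference]
    exact Submodule.sub_mem _ hf hr

lemma eval_hecke (t : ℂ) (i : Fin m) (f : MvPolynomial (Fin (m + 1)) ℂ)
    (x : Fin (m + 1) → ℂ) : (x i.castSucc - x i.succ) * eval x (hecke t i f) =
      (x i.castSucc - x i.succ) * eval (x ∘ adj i) f +
        (1 - t⁻¹) * x i.castSucc * (eval x f - eval (x ∘ adj i) f) := by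
  have := congrArg (eval x) (mul_dividedDifference i f)
  simp only [map_mul, map_sub, eval_X, eval_rename] at this
  rw [hecke_apply, map_add, smul_eval, map_mul, eval_X, eval_rename, ← this]
  ring

lemma eval_hecke_of_eq_zero (t : ℂ) (i : Fin m) (f : MvPolynomial (Fin (m + 1)) ℂ)
    {x : Fin (m + 1) → ℂ} (hx : x i.castSucc = 0) :
    eval x (hecke t i f) = eval (x ∘ adj i) f := by
  rw [hecke_apply, map_add, smul_eval, map_mul, eval_X, eval_rename, hx]
  simp

/-- At a point with `x_i = t x_{i+1}` the Hecke operator acts trivially. -/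
lemma eval_hecke_of_eq_mul {t : ℂ} (ht : t ≠ 0) (i : Fin m) (f : MvPolynomial (Fin (m + 1)) ℂ)
    {x : Fin (m + 1) → ℂ} (hx : x i.castSucc = t * x i.succ) (hne : x i.castSucc ≠ x i.succ) :
    eval x (hecke t i f) = eval x f := by
  apply mul_left_cancel₀ (sub_ne_zero.2 hne)
  rw [eval_hecke]
  have : (1 - t⁻¹) * x i.castSucc = x i.castSucc - x i.succ := by
    rw [hx]; field_simp
  rw [this]
  ring

lemma eval_spec_hecke {q t : ℂ} (h : Generic q t) (i : Fin m) (w : Fin (m + 1) → ℕ)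
    {f : MvPolynomial (Fin (m + 1)) ℂ} (h1 : eval (spec q t w) f = 0)
    (h2 : eval (spec q t (w ∘ adj i)) f = 0) : eval (spec q t w) (hecke t i f) = 0 := by
  by_cases hw : w i.castSucc = w i.succ
  · rw [eval_hecke_of_eq_mul h.t_ne i f (spec_castSucc_of_eq h.t_ne w i hw)
      (spec_castSucc_ne h w i), h1]
  · apply mul_left_cancel₀ (sub_ne_zero.2 (spec_castSucc_ne h w i))
    rw [eval_hecke, ← spec_adj q t w i hw, h1, h2]
    ring

lemma scale_rename (s : ℂ) (e : Equiv.Perm (Fin n)) (f : MvPolynomial (Fin n) ℂ) :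
    scale s (rename e f) = rename e (scale s f) := by
  refine MvPolynomial.funext fun x => ?_
  rw [eval_scale, eval_rename, eval_rename, eval_scale]
  rfl

lemma scale_X (s : ℂ) (i : Fin n) : scale s (X i) = C s * X i := by
  simp [scale]

lemma scale_hecke (s t : ℂ) (i : Fin m) (f : MvPolynomial (Fin (m + 1)) ℂ) :
    scale s (hecke t i f) = hecke t i (scale s f) := by
  have h1 : C s * scale s (dividedDifference i f) = dividedDifference i (scale s f) := by
    apply mul_left_cancel₀ (X_sub_X_ne_zero i)
    rw [mul_dividedDifference, ← scale_rename, ← map_sub, ← mul_dividedDifference, map_mul,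
      map_sub, scale_X, scale_X]
    ring
  rw [hecke_apply, hecke_apply, map_add, map_smul, scale_rename, map_mul, scale_X, ← h1]
  congr 2
  ring

/-- The cyclic permutation produced by the first `k` adjacent transpositions. -/
def cyc : (k : ℕ) → k ≤ m → Equiv.Perm (Fin (m + 1))
  | 0, _ => Equiv.refl _
  | k + 1, hk => (adj ⟨k, hk⟩).trans (cyc k (Nat.le_of_succ_le hk))

/-- The product `H_1 ⋯ H_k` of Hecke operators. -/
def heckeProd (t : ℂ) : (k : ℕ) → k ≤ m →
    MvPolynomial (Fin (m + 1)) ℂ →ₗ[ℂ] MvPolynomial (Fin (m + 1)) ℂ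
  | 0, _ => LinearMap.id
  | k + 1, hk => (heckeProd t k (Nat.le_of_succ_le hk)).comp (hecke t ⟨k, hk⟩)

lemma cyc_apply (k : ℕ) (hk : k ≤ m) (j : Fin (m + 1)) :
    ((cyc k hk j : Fin (m + 1)) : ℕ) =
      if (j : ℕ) < k then (j : ℕ) + 1 else if (j : ℕ) = k then 0 else j := by
  induction k generalizing j with
  | zero => simp [cyc]
  | succ k ih =>
    simp only [cyc, Equiv.trans_apply, ih, adj, Equiv.swap_apply_def, Fin.ext_iff]
    simp only [Fin.val_castSucc, Fin.val_succ]
    split_ifs <;> simp_all <;> omega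

lemma heckeProd_mem_degLT (t : ℂ) (k : ℕ) (hk : k ≤ m) {d : ℕ}
    {f : MvPolynomial (Fin (m + 1)) ℂ} (hf : f ∈ degLT (m + 1) d) :
    heckeProd t k hk f ∈ degLT (m + 1) d := by
  induction k generalizing f with
  | zero => exact hf
  | succ k ih => exact ih _ (hecke_mem_degLT t _ hf)

lemma scale_heckeProd (s t : ℂ) (k : ℕ) (hk : k ≤ m) (f : MvPolynomial (Fin (m + 1)) ℂ) :
    scale s (heckeProd t k hk f) = heckeProd t k hk (scale s f) := by
  induction k generalizing f with
  | zero => rfl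
  | succ k ih => simp only [heckeProd, LinearMap.comp_apply, ih, scale_hecke]

lemma eval_spec_heckeProd {q t : ℂ} (h : Generic q t) (k : ℕ) (hk : k ≤ m)
    (w : Fin (m + 1) → ℕ) {f : MvPolynomial (Fin (m + 1)) ℂ}
    (hf : ∀ v, Similar q t v w → eval (spec q t v) f = 0) :
    eval (spec q t w) (heckeProd t k hk f) = 0 := by
  induction k generalizing f with
  | zero => exact hf w (Similar.refl q t w)
  | succ k ih =>
    exact ih _ fun v hv => eval_spec_hecke h _ v (hf v hv)
      (hf _ ((similar_adj q t v _).trans hv))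

lemma eval_heckeProd_of_eq_zero (t : ℂ) (k : ℕ) (hk : k ≤ m) (f : MvPolynomial (Fin (m + 1)) ℂ)
    {x : Fin (m + 1) → ℂ} (hx : x 0 = 0) :
    eval x (heckeProd t k hk f) = eval (x ∘ cyc k hk) f := by
  induction k generalizing f with
  | zero => rfl
  | succ k ih =>
    rw [heckeProd, LinearMap.comp_apply, ih, eval_hecke_of_eq_zero]
    · rfl
    · have : cyc k (Nat.le_of_succ_le hk) (Fin.castSucc ⟨k, hk⟩) = 0 := by
        rw [Fin.ext_iff, cyc_apply]; simp
      rw [Function.comp, this, hx]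

/-- The product `H_1 ⋯ H_{n-1}` of Hecke operators. -/
def heckeCycle (m : ℕ) (t : ℂ) :
    MvPolynomial (Fin (m + 1)) ℂ →ₗ[ℂ] MvPolynomial (Fin (m + 1)) ℂ :=
  heckeProd t m le_rfl

lemma eval_heckeCycle_of_eq_zero (q t : ℂ) (f : MvPolynomial (Fin (m + 1)) ℂ)
    {x : Fin (m + 1) → ℂ} (hx : x 0 = 0) :
    eval x (heckeCycle m t f) = eval (shiftPt q x) f := by
  rw [heckeCycle, eval_heckeProd_of_eq_zero t m le_rfl f hx]
  congr 2
  funext i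
  refine Fin.lastCases ?_ (fun i => ?_) i
  · have : cyc m le_rfl (Fin.last m) = 0 := by rw [Fin.ext_iff, cyc_apply]; simp
    simp [this, hx]
  · have : cyc m le_rfl i.castSucc = i.succ := by rw [Fin.ext_iff, cyc_apply]; simp
    simp [this]

lemma exists_lowering (q t : ℂ) :
    ∃ G : MvPolynomial (Fin (m + 1)) ℂ →ₗ[ℂ] MvPolynomial (Fin (m + 1)) ℂ,
      ∀ f, X 0 * G f = shift q f - heckeCycle m t f := by
  refine exists_linear_div (X_ne_zero _) ((shift q).toLinearMap - heckeCycle m t) fun f => ?_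
  have : X 0 - C 0 ∣ shift q f - heckeCycle m t f := by
    refine X_sub_dvd fun x => ?_
    rw [map_sub, eval_heckeCycle_of_eq_zero q t f (by simp), eval_shift, sub_self]
  simpa using this

/-- The lowering operator `x_1⁻¹ (f(x_2, …, x_n, q x_1) - H_1 ⋯ H_{n-1} f)`. -/
def lowering (m : ℕ) (q t : ℂ) :
    MvPolynomial (Fin (m + 1)) ℂ →ₗ[ℂ] MvPolynomial (Fin (m + 1)) ℂ :=
  (exists_lowering q t).choose

lemma X_mul_lowering (q t : ℂ) (f : MvPolynomial (Fin (m + 1)) ℂ) :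
    X 0 * lowering m q t f = shift q f - heckeCycle m t f :=
  (exists_lowering q t).choose_spec f

lemma lowering_mem_degLT (q t : ℂ) {d : ℕ} {f : MvPolynomial (Fin (m + 1)) ℂ}
    (hf : f ∈ degLT (m + 1) (d + 1)) : lowering m q t f ∈ degLT (m + 1) d := by
  refine mem_degLT_of_mul_mem (p := X 0) (totalDegree_X _).ge ?_
  rw [X_mul_lowering]
  exact Submodule.sub_mem _ (shift_mem_degLT q hf) (heckeProd_mem_degLT t _ _ hf)

lemma scale_shift (s q : ℂ) (f : MvPolynomial (Fin (m + 1)) ℂ) :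
    scale s (shift q f) = shift q (scale s f) := by
  refine MvPolynomial.funext fun x => ?_
  rw [eval_scale, eval_shift, eval_shift, eval_scale]
  congr 2
  funext i
  refine Fin.lastCases ?_ (fun i => ?_) i
  · simp; ring
  · simp

lemma scale_lowering (s q t : ℂ) (f : MvPolynomial (Fin (m + 1)) ℂ) :
    s • scale s (lowering m q t f) = lowering m q t (scale s f) := by
  apply mul_left_cancel₀ (X_ne_zero (R := ℂ) (0 : Fin (m + 1)))
  rw [X_mul_lowering, ← scale_shift, heckeCycle, ← scale_heckeProd, ← map_sub, ← heckeCycle,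
    ← X_mul_lowering, map_mul, scale_X, smul_eq_C_mul]
  ring

end Hecke

section Intertwining

variable {m : ℕ} {q t : ℂ} {B : (Fin (m + 1) → ℕ) → MvPolynomial (Fin (m + 1)) ℂ}

lemma spec_last_of_eq_zero (q t : ℂ) {v : Fin (m + 1) → ℕ} (hv : v (Fin.last m) = 0) :
    spec q t v (Fin.last m) = 1 := by
  rw [← Fin.snoc_init_self v, hv, spec_snoc_zero, Fin.snoc_last]

lemma Interp.exists_raise_smul (h : Generic q t) (hB : Interp q t B) (w : Fin (m + 1) → ℕ) :
    ∃ γ : ℂ, (X (Fin.last m) - C 1) * unshift q (B w) = γ • B (raise w) := by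
  refine hB.eq_smul_of_vanish h ?_ fun v hv hne => ?_
  · rw [wt_raise]
    exact mul_mem_degLT (totalDegree_X_sub_le (by simp)) (unshift_mem_degLT q (hB.mem w))
  · rw [map_mul]
    by_cases hl : v (Fin.last m) = 0
    · simp [spec_last_of_eq_zero q t hl]
    · obtain ⟨v, rfl⟩ := exists_raise hl
      rw [wt_raise, wt_raise] at hv
      rw [eval_unshift, spec_raise, unshiftPt_shiftPt h.q_ne,
        hB.van w v (by omega) fun he => hne (by rw [he]), mul_zero]

lemma Interp.eval_heckeCycle_eq_zero (h : Generic q t) (hB : Interp q t B)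
    {u v : Fin (m + 1) → ℕ} (huv : wt v < wt u) :
    eval (spec q t v) (heckeCycle m t (B u)) = 0 :=
  eval_spec_heckeProd h _ _ v fun v' hv' =>
    hB.van u v' (hv'.1.trans_lt huv).le fun he => huv.ne (he ▸ hv'.1).symm

lemma Interp.exists_X_zero_mul (h : Generic q t) (hB : Interp q t B) (w : Fin (m + 1) → ℕ) :
    ∃ γ : ℂ, X 0 * B w = spec q t w 0 • (B w + γ • heckeCycle m t (B (raise w))) := by
  obtain ⟨γ, hγ⟩ := hB.exists_raise_smul h w
  refine ⟨γ, ?_⟩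
  set F := B w + γ • heckeCycle m t (B (raise w)) with hF
  have hdvd : X 0 - C 0 ∣ F := by
    refine X_sub_dvd fun x => ?_
    rw [hF, ← map_smul, ← hγ, map_add, eval_heckeCycle_of_eq_zero q t _ (by simp), map_mul,
      eval_unshift, unshiftPt_shiftPt h.q_ne]
    simp
  obtain ⟨G, hG⟩ := hdvd
  rw [map_zero, sub_zero] at hG
  have hFmem : F ∈ degLT (m + 1) (wt w + 1 + 1) := by
    refine Submodule.add_mem _ (degLT_mono (Nat.le_succ _) (hB.mem w))
      (Submodule.smul_mem _ _ (heckeProd_mem_degLT t _ _ ?_))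
    rw [← wt_raise]
    exact hB.mem _
  have hGmem : G ∈ degLT (m + 1) (wt w + 1) :=
    mem_degLT_of_mul_mem (p := X 0) (totalDegree_X _).ge (hG ▸ hFmem)
  have hGB : B w - spec q t w 0 • G = 0 := by
    refine eq_zero_of_eval_spec h _ (wt w + 1) _
      (Submodule.sub_mem _ (hB.mem w) (Submodule.smul_mem _ _ hGmem)) fun v hv => ?_
    have hev := congrArg (eval (spec q t v)) hG
    rw [hF, map_add, smul_eval, hB.eval_heckeCycle_eq_zero h (by rwa [wt_raise]), mul_zero,
      add_zero, map_mul, eval_X] at hev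
    rw [map_sub, smul_eval]
    by_cases hvw : v = w
    · rw [hev, hvw, sub_self]
    · rw [hB.van w v (by omega) hvw] at hev ⊢
      rw [(mul_eq_zero.1 hev.symm).resolve_left (spec_ne_zero h v 0), mul_zero, sub_zero]
  rw [sub_eq_zero.1 hGB, mul_smul_comm, ← hG]

lemma eval_lowering_eq_zero (h : Generic q t) (hB : Interp q t B) {u v : Fin (m + 1) → ℕ}
    (hv : wt v < wt u) (hne : raise v ≠ u) : eval (spec q t v) (lowering m q t (B u)) = 0 := by
  have := congrArg (eval (spec q t v)) (X_mul_lowering q t (B u))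
  rw [map_mul, eval_X, map_sub, eval_shift, ← spec_raise,
    hB.van u _ (by rw [wt_raise]; omega) hne, hB.eval_heckeCycle_eq_zero h hv, sub_zero] at this
  exact (mul_eq_zero.1 this).resolve_left (spec_ne_zero h v 0)

lemma Interp.lowering_eq_zero (h : Generic q t) (hB : Interp q t B) {u : Fin (m + 1) → ℕ}
    (hu : u (Fin.last m) = 0) : lowering m q t (B u) = 0 :=
  eq_zero_of_eval_spec h _ (wt u) _ (lowering_mem_degLT q t (hB.mem u)) fun v hv =>
    eval_lowering_eq_zero h hB hv fun he => by
      have := congrFun he (Fin.last m)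
      rw [raise_last, hu] at this
      omega

lemma Interp.exists_lowering_raise (h : Generic q t) (hB : Interp q t B)
    (w : Fin (m + 1) → ℕ) : ∃ ρ : ℂ, lowering m q t (B (raise w)) = ρ • B w := by
  refine hB.eq_smul_of_vanish h ?_ fun v hv hne => ?_
  · rw [← wt_raise]
    exact lowering_mem_degLT q t (hB.mem _)
  · exact eval_lowering_eq_zero h hB (by rw [wt_raise]; omega) fun he => hne (raise_injective he)

lemma Interp.diagOp_heckeCycle (h : Generic q t) (hB : Interp q t B)
    {φ : (Fin (m + 1) → ℕ) → ℂ} (u : Fin (m + 1) → ℕ)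
    (hφ : ∀ v, Similar q t v u → φ v = φ u) :
    hB.diagOp h φ (heckeCycle m t (B u)) = φ u • heckeCycle m t (B u) := by
  have hmem := hB.mem_span_of_vanish h {v | Similar q t v u}
    (heckeProd_mem_degLT t m le_rfl (hB.mem u)) fun v hv hvu => by
      refine eval_spec_heckeProd h _ _ v fun v' hv' => ?_
      refine hB.van u v' (hv'.1.trans_le hv) fun he => ?_
      subst he
      exact hvu ⟨hv'.1.symm, hv'.symm⟩
  have hle : Submodule.span ℂ (B '' {v | wt v = wt u ∧ v ∈ {v | Similar q t v u}}) ≤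
      LinearMap.ker (hB.diagOp h φ - φ u • LinearMap.id) := by
    rw [Submodule.span_le]
    rintro _ ⟨v, hv, rfl⟩
    rw [SetLike.mem_coe, LinearMap.mem_ker, LinearMap.sub_apply, hB.diagOp_apply, hφ v hv.2]
    simp
  have := hle hmem
  rwa [LinearMap.mem_ker, LinearMap.sub_apply, sub_eq_zero] at this

/-- The eigenvalues `(z)_u / z^{|u|}`. -/
def qfacNorm (q t z : ℂ) (u : Fin n → ℕ) : ℂ := qfac q t z u / z ^ wt u

/-- The operator `z⁻¹ δ - t^{1-n} σ`, where `δ` is the lowering operator and `σ` the cyclic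
shift. -/
def mixedOp (m : ℕ) (q t z : ℂ) :
    MvPolynomial (Fin (m + 1)) ℂ →ₗ[ℂ] MvPolynomial (Fin (m + 1)) ℂ :=
  z⁻¹ • lowering m q t - (t ^ m)⁻¹ • (shift q).toLinearMap

lemma mixedOp_apply (q t z : ℂ) (f : MvPolynomial (Fin (m + 1)) ℂ) :
    mixedOp m q t z f = z⁻¹ • lowering m q t f - (t ^ m)⁻¹ • shift q f := rfl

lemma scale_mixedOp (q t : ℂ) {z s : ℂ} (hs : s ≠ 0) (f : MvPolynomial (Fin (m + 1)) ℂ) :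
    scale s (mixedOp m q t z f) = mixedOp m q t (s * z) (scale s f) := by
  rw [mixedOp_apply, mixedOp_apply, map_sub, map_smul, map_smul, ← scale_lowering, scale_shift,
    smul_smul, mul_inv, mul_right_comm, inv_mul_cancel₀ hs, one_mul]

lemma Interp.exists_diagOp_mixedOp_basis (h : Generic q t) (hB : Interp q t B)
    (u : Fin (m + 1) → ℕ) : ∃ κ : ℂ, ∀ z, z ≠ 0 →
      hB.diagOp h (qfacNorm q t z) (mixedOp m q t z (B u)) =
        qfacNorm q t z u • (κ • lowering m q t (B u) - (t ^ m)⁻¹ • shift q (B u)) := by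
  have hφ : ∀ z v, Similar q t v u → qfacNorm q t z v = qfacNorm q t z u := fun z v hv => by
    rw [qfacNorm, qfacNorm, hv.1, hv.2]
  have hsh : shift q (B u) = heckeCycle m t (B u) + X 0 * lowering m q t (B u) := by
    rw [X_mul_lowering]; ring
  by_cases hl : u (Fin.last m) = 0
  · refine ⟨0, fun z hz => ?_⟩
    rw [hB.lowering_eq_zero h hl, mul_zero, add_zero] at hsh
    rw [mixedOp_apply, hB.lowering_eq_zero h hl, hsh, map_sub, map_smul, map_smul,
      hB.diagOp_heckeCycle h u (hφ z), map_zero]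
    module
  · obtain ⟨w, rfl⟩ := exists_raise hl
    obtain ⟨ρ, hρ⟩ := hB.exists_lowering_raise h w
    obtain ⟨γ, hγ⟩ := hB.exists_X_zero_mul h w
    refine ⟨1 + spec q t w 0 / t ^ m, fun z hz => ?_⟩
    have hn : qfacNorm q t z (raise w) =
        qfacNorm q t z w * (z⁻¹ - spec q t w 0 / t ^ m) := by
      rw [qfacNorm, qfacNorm, qfac_raise h.t_ne, wt_raise, pow_succ]
      have := h.t_ne
      field_simp
    rw [hρ, mul_smul_comm, hγ] at hsh
    rw [mixedOp_apply, hρ, hsh, map_sub, map_smul, map_smul, map_smul, map_add, map_smul, map_smul,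
      map_add, map_smul, hB.diagOp_heckeCycle h _ (hφ z), hB.diagOp_apply, hn]
    have := h.t_ne
    match_scalars
    · field_simp
      ring
    · ring

/-- An operator agreeing with the cyclic shift up to terms of lower degree. -/
def ShiftLike (q : ℂ) (A : MvPolynomial (Fin (m + 1)) ℂ →ₗ[ℂ] MvPolynomial (Fin (m + 1)) ℂ) :
    Prop :=
  ∀ d f, f ∈ degLT (m + 1) (d + 1) → A f - shift q f ∈ degLT (m + 1) d

lemma ShiftLike.mem {A : MvPolynomial (Fin (m + 1)) ℂ →ₗ[ℂ] MvPolynomial (Fin (m + 1)) ℂ}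
    (hA : ShiftLike q A) {d : ℕ} {f : MvPolynomial (Fin (m + 1)) ℂ}
    (hf : f ∈ degLT (m + 1) d) : A f ∈ degLT (m + 1) d := by
  cases d with
  | zero => simp [eq_zero_of_mem_degLT_zero hf]
  | succ d =>
    rw [← sub_add_cancel (A f) (shift q f)]
    exact Submodule.add_mem _ (degLT_mono (Nat.le_succ d) (hA d f hf)) (shift_mem_degLT q hf)

lemma shift_iterate_mem_degLT (q : ℂ) (k : ℕ) {d : ℕ} {f : MvPolynomial (Fin (m + 1)) ℂ}
    (hf : f ∈ degLT (m + 1) d) : (shift q)^[k] f ∈ degLT (m + 1) d := by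
  induction k with
  | zero => exact hf
  | succ k ih =>
    rw [Function.iterate_succ_apply']
    exact shift_mem_degLT q ih

lemma ShiftLike.iterate {A : MvPolynomial (Fin (m + 1)) ℂ →ₗ[ℂ] MvPolynomial (Fin (m + 1)) ℂ}
    (hA : ShiftLike q A) (k : ℕ) {d : ℕ} {f : MvPolynomial (Fin (m + 1)) ℂ}
    (hf : f ∈ degLT (m + 1) (d + 1)) : A^[k] f - (shift q)^[k] f ∈ degLT (m + 1) d := by
  induction k with
  | zero => simp
  | succ k ih =>
    rw [Function.iterate_succ_apply', Function.iterate_succ_apply',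
      ← sub_add_sub_cancel _ (A ((shift q)^[k] f)), ← map_sub]
    exact Submodule.add_mem _ (hA.mem ih) (hA d _ (shift_iterate_mem_degLT q k hf))

lemma shiftPt_iterate (q : ℂ) (x : Fin (m + 1) → ℂ) (k : ℕ) (i j : Fin (m + 1)) :
    ((i : ℕ) + k = j → (shiftPt q)^[k] x i = x j) ∧
      ((i : ℕ) + k = j + (m + 1) → (shiftPt q)^[k] x i = q * x j) := by
  induction k generalizing i with
  | zero =>
    refine ⟨fun hij => ?_, fun hij => ?_⟩
    · rw [Fin.ext (by simpa using hij) (a := i) (b := j)]; rfl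
    · omega
  | succ k ih =>
    rw [Function.iterate_succ_apply']
    refine Fin.lastCases ?_ (fun i => ?_) i
    · rw [shiftPt_last, Fin.val_last]
      refine ⟨fun hij => by omega, fun hij => ?_⟩
      rw [(ih 0).1 (by simp only [Fin.val_zero]; omega)]
    · rw [shiftPt_castSucc, Fin.val_castSucc]
      refine ⟨fun hij => (ih i.succ).1 ?_, fun hij => (ih i.succ).2 ?_⟩ <;>
        rw [Fin.val_succ] <;> omega

lemma eval_shift_iterate (q : ℂ) (x : Fin (m + 1) → ℂ) (k : ℕ)
    (f : MvPolynomial (Fin (m + 1)) ℂ) :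
    eval x ((shift q)^[k] f) = eval ((shiftPt q)^[k] x) f := by
  induction k generalizing x with
  | zero => rfl
  | succ k ih =>
    rw [Function.iterate_succ_apply', eval_shift, ih, Function.iterate_succ_apply]

lemma shift_iterate_eq_scale (q : ℂ) (f : MvPolynomial (Fin (m + 1)) ℂ) :
    (shift q)^[m + 1] f = scale q f := by
  refine MvPolynomial.funext fun x => ?_
  rw [eval_shift_iterate, eval_scale]
  congr 2
  funext i
  exact (shiftPt_iterate q x (m + 1) i i).2 rfl

lemma ShiftLike.iterate_sub_smul_mem
    {A : MvPolynomial (Fin (m + 1)) ℂ →ₗ[ℂ] MvPolynomial (Fin (m + 1)) ℂ}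
    (hA : ShiftLike q A) {d : ℕ} {f : MvPolynomial (Fin (m + 1)) ℂ}
    (hf : f ∈ degLT (m + 1) (d + 1)) : A^[m + 1] f - q ^ d • f ∈ degLT (m + 1) d := by
  rw [← sub_add_sub_cancel _ (scale q f)]
  refine Submodule.add_mem _ ?_ (scale_sub_mem_degLT q hf)
  rw [← shift_iterate_eq_scale]
  exact hA.iterate _ hf

/-- An intertwiner between two shift-like operators which lowers the degree vanishes. -/
theorem eq_zero_of_intertwines (h : Generic q t)
    {A L R : MvPolynomial (Fin (m + 1)) ℂ →ₗ[ℂ] MvPolynomial (Fin (m + 1)) ℂ}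
    (hA : ShiftLike q A) (hL : ShiftLike q L) (hR : ∀ f, R (A f) = L (R f))
    (hdeg : ∀ d f, f ∈ degLT (m + 1) (d + 1) → R f ∈ degLT (m + 1) d) : R = 0 := by
  have hit : ∀ k f, R (A^[k] f) = L^[k] (R f) := fun k => by
    induction k with
    | zero => exact fun f => rfl
    | succ k ih =>
      intro f
      rw [Function.iterate_succ_apply', Function.iterate_succ_apply', hR, ih]
  have key : ∀ e d f, f ∈ degLT (m + 1) (d + (e + 1)) → R f ∈ degLT (m + 1) d := by
    intro e
    induction e with
    | zero => exact hdeg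
    | succ e ih =>
      intro d f hf
      have h1 := ih d _ (hA.iterate_sub_smul_mem (d := d + (e + 1)) hf)
      have h2 := hL.iterate_sub_smul_mem (ih (d + 1) f
        (by rwa [show d + 1 + (e + 1) = d + (e + 1 + 1) by omega]))
      rw [map_sub, map_smul, hit] at h1
      have h3 := Submodule.sub_mem _ h2 h1
      rw [sub_sub_sub_cancel_left, ← sub_smul] at h3
      refine (Submodule.smul_mem_iff _ (sub_ne_zero.2 ?_)).1 h3
      have := h.mul_ne_mul (a := d + (e + 1)) (b := d) (c := 0) (d := 0) (Or.inl (by omega))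
      simpa using this
  refine LinearMap.ext fun f => ?_
  obtain ⟨d, hd⟩ := exists_mem_degLT f
  exact eq_zero_of_mem_degLT_zero (key d 0 f (degLT_mono (by omega) hd))

lemma shiftLike_mixedOp (h : Generic q t) (z : ℂ) :
    ShiftLike q (-t ^ m • mixedOp m q t z) := by
  intro d f hf
  have : (-t ^ m • mixedOp m q t z) f - shift q f = (-t ^ m * z⁻¹) • lowering m q t f := by
    have := pow_ne_zero m h.t_ne
    rw [LinearMap.smul_apply, mixedOp_apply]
    match_scalars <;> field_simp
    ring
  rw [this]
  exact Submodule.smul_mem _ _ (lowering_mem_degLT q t hf)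

lemma Interp.exists_diagOp_mixedOp (h : Generic q t) (hB : Interp q t B) :
    ∃ L : MvPolynomial (Fin (m + 1)) ℂ →ₗ[ℂ] MvPolynomial (Fin (m + 1)) ℂ,
      ShiftLike q (-t ^ m • L) ∧ ∀ z, z ≠ 0 → ∀ f,
        hB.diagOp h (qfacNorm q t z) (mixedOp m q t z f) =
          L (hB.diagOp h (qfacNorm q t z) f) := by
  choose κ hκ using hB.exists_diagOp_mixedOp_basis h
  set L := (hB.basis h).constr ℂ fun u =>
    κ u • lowering m q t (B u) - (t ^ m)⁻¹ • shift q (B u) with hLdef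
  have hL : ∀ u, L (B u) = κ u • lowering m q t (B u) - (t ^ m)⁻¹ • shift q (B u) := fun u => by
    conv_lhs => rw [← hB.basis_apply h u]
    rw [hLdef, Module.Basis.constr_basis]
  refine ⟨L, fun d f hf => ?_, fun z hz f => ?_⟩
  · refine hB.map_mem_of_forall h (L := -t ^ m • L - (shift q).toLinearMap) (fun u hu => ?_) hf
    rw [LinearMap.sub_apply, LinearMap.smul_apply, hL, AlgHom.toLinearMap_apply]
    have : -t ^ m • (κ u • lowering m q t (B u) - (t ^ m)⁻¹ • shift q (B u)) - shift q (B u) =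
        (-t ^ m * κ u) • lowering m q t (B u) := by
      have := pow_ne_zero m h.t_ne
      match_scalars <;> field_simp
      ring
    rw [this]
    exact Submodule.smul_mem _ _ (degLT_mono (Nat.lt_succ_iff.1 hu)
      (lowering_mem_degLT q t (hB.mem u)))
  · have := hB.hom_ext h (L := (hB.diagOp h (qfacNorm q t z)).comp (mixedOp m q t z))
      (L' := L.comp (hB.diagOp h (qfacNorm q t z))) fun u => by
        rw [LinearMap.comp_apply, LinearMap.comp_apply, hκ u z hz, hB.diagOp_apply, map_smul, hL]
    exact LinearMap.congr_fun this f

end Intertwining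

section Connection

variable {m : ℕ} {q t : ℂ} {B : (Fin (m + 1) → ℕ) → MvPolynomial (Fin (m + 1)) ℂ}

/-- The operator `T` acts on each `B u` by `θ u`, up to terms of lower degree. -/
def LeadsTo (B : (Fin n → ℕ) → MvPolynomial (Fin n) ℂ)
    (T : MvPolynomial (Fin n) ℂ →ₗ[ℂ] MvPolynomial (Fin n) ℂ) (θ : (Fin n → ℕ) → ℂ) : Prop :=
  ∀ u, T (B u) - θ u • B u ∈ degLT n (wt u)

lemma LeadsTo.mem {B : (Fin n → ℕ) → MvPolynomial (Fin n) ℂ} (h : Generic q t)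
    (hB : Interp q t B) {T : MvPolynomial (Fin n) ℂ →ₗ[ℂ] MvPolynomial (Fin n) ℂ}
    {θ : (Fin n → ℕ) → ℂ} (hT : LeadsTo B T θ) {d : ℕ} {f : MvPolynomial (Fin n) ℂ}
    (hf : f ∈ degLT n d) : T f ∈ degLT n d := by
  refine hB.map_mem_of_forall h (fun u hu => ?_) hf
  rw [← sub_add_cancel (T (B u)) (θ u • B u)]
  exact Submodule.add_mem _ (degLT_mono hu.le (hT u))
    (Submodule.smul_mem _ _ (degLT_mono hu (hB.mem u)))

lemma LeadsTo.comp {B : (Fin n → ℕ) → MvPolynomial (Fin n) ℂ} (h : Generic q t)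
    (hB : Interp q t B) {T T' : MvPolynomial (Fin n) ℂ →ₗ[ℂ] MvPolynomial (Fin n) ℂ}
    {θ θ' : (Fin n → ℕ) → ℂ} (hT : LeadsTo B T θ) (hT' : LeadsTo B T' θ') :
    LeadsTo B (T.comp T') fun u => θ u * θ' u := by
  intro u
  have : (T.comp T') (B u) - (θ u * θ' u) • B u =
      T (T' (B u) - θ' u • B u) + θ' u • (T (B u) - θ u • B u) := by
    rw [LinearMap.comp_apply, map_sub, map_smul]
    module
  rw [this]
  exact Submodule.add_mem _ (hT.mem h hB (hT' u)) (Submodule.smul_mem _ _ (hT u))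

lemma Interp.leadsTo_diagOp {B : (Fin n → ℕ) → MvPolynomial (Fin n) ℂ} (h : Generic q t)
    (hB : Interp q t B) (φ : (Fin n → ℕ) → ℂ) : LeadsTo B (hB.diagOp h φ) φ := by
  intro u
  rw [hB.diagOp_apply, sub_self]
  exact Submodule.zero_mem _

lemma Interp.leadsTo_scale {B : (Fin n → ℕ) → MvPolynomial (Fin n) ℂ} (hB : Interp q t B)
    (s : ℂ) : LeadsTo B (scale s).toLinearMap fun u => s ^ wt u :=
  fun u => scale_sub_mem_degLT s (hB.mem u)

/-- The two factorizations of the connection operator coincide. -/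
theorem Interp.factorization (h : Generic q t) (hB : Interp q t B) {a b c : ℂ} (ha : a ≠ 0)
    (hb : b ≠ 0) (hc : c ≠ 0) (hcv : ∀ v : Fin (m + 1) → ℕ, qfac q t c v ≠ 0)
    (f : MvPolynomial (Fin (m + 1)) ℂ) :
    hB.diagOp h (qfacNorm q t b) (scale (b / c) (hB.diagOp h (fun v => (qfacNorm q t c v)⁻¹)
      (hB.diagOp h (qfacNorm q t a) (scale (a / b) f)))) =
    hB.diagOp h (qfacNorm q t a) (scale (a / c) (hB.diagOp h (fun v => (qfacNorm q t c v)⁻¹)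
      (hB.diagOp h (qfacNorm q t b) f))) := by
  set Dinv := hB.diagOp h (fun v => (qfacNorm q t c v)⁻¹) with hDinv
  obtain ⟨L, hLs, hL⟩ := hB.exists_diagOp_mixedOp h
  have hne : ∀ v : Fin (m + 1) → ℕ, qfacNorm q t c v ≠ 0 := fun v =>
    div_ne_zero (hcv v) (pow_ne_zero _ hc)
  have hleft : ∀ g, Dinv (hB.diagOp h (qfacNorm q t c) g) = g := fun g => by
    have := hB.hom_ext h (L := Dinv.comp (hB.diagOp h (qfacNorm q t c)))
      (L' := LinearMap.id) fun u => by
        rw [LinearMap.comp_apply, hB.diagOp_apply, map_smul, hDinv, hB.diagOp_apply, smul_smul,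
          mul_inv_cancel₀ (hne u), one_smul, LinearMap.id_apply]
    exact LinearMap.congr_fun this g
  have hright : ∀ g, hB.diagOp h (qfacNorm q t c) (Dinv g) = g := fun g => by
    have := hB.hom_ext h (L := (hB.diagOp h (qfacNorm q t c)).comp Dinv)
      (L' := LinearMap.id) fun u => by
        rw [LinearMap.comp_apply, hDinv, hB.diagOp_apply, map_smul, hB.diagOp_apply, smul_smul,
          inv_mul_cancel₀ (hne u), one_smul, LinearMap.id_apply]
    exact LinearMap.congr_fun this g
  have hinv : ∀ g, Dinv (L g) = mixedOp m q t c (Dinv g) := fun g => by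
    rw [← hleft (mixedOp m q t c (Dinv g)), hL c hc, hright]
  have hscale : ∀ {y z : ℂ}, y ≠ 0 → z ≠ 0 → ∀ g,
      scale (y / z) (mixedOp m q t z g) = mixedOp m q t y (scale (y / z) g) := by
    intro y z hy hz g
    rw [scale_mixedOp q t (div_ne_zero hy hz), div_mul_cancel₀ _ hz]
  set Q₁ := (hB.diagOp h (qfacNorm q t b)).comp ((scale (b / c)).toLinearMap.comp
    (Dinv.comp ((hB.diagOp h (qfacNorm q t a)).comp (scale (a / b)).toLinearMap))) with hQ₁
  set Q₂ := (hB.diagOp h (qfacNorm q t a)).comp ((scale (a / c)).toLinearMap.comp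
    (Dinv.comp (hB.diagOp h (qfacNorm q t b)))) with hQ₂
  have hzero : Q₁ - Q₂ = 0 := by
    refine eq_zero_of_intertwines h (shiftLike_mixedOp h b) hLs (fun g => ?_) fun d g hg => ?_
    · rw [LinearMap.smul_apply, LinearMap.smul_apply, map_smul]
      congr 1
      simp only [hQ₁, hQ₂, LinearMap.sub_apply, LinearMap.comp_apply, AlgHom.toLinearMap_apply]
      rw [hscale ha hb, hL a ha, hinv, hscale hb hc, hL b hb, hL b hb, hinv, hscale ha hc, hL a ha,
        map_sub]
    · refine hB.map_mem_of_forall h (fun u hu => ?_) hg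
      have h1 := ((hB.leadsTo_diagOp h (qfacNorm q t b)).comp h hB ((hB.leadsTo_scale (b / c)).comp
        h hB ((hB.leadsTo_diagOp h fun v => (qfacNorm q t c v)⁻¹).comp h hB
          ((hB.leadsTo_diagOp h (qfacNorm q t a)).comp h hB (hB.leadsTo_scale (a / b)))))) u
      have h2 := ((hB.leadsTo_diagOp h (qfacNorm q t a)).comp h hB ((hB.leadsTo_scale (a / c)).comp
        h hB ((hB.leadsTo_diagOp h fun v => (qfacNorm q t c v)⁻¹).comp h hB
          (hB.leadsTo_diagOp h (qfacNorm q t b))))) u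
      have hθ : qfacNorm q t b u * ((b / c) ^ wt u * ((qfacNorm q t c u)⁻¹ *
          (qfacNorm q t a u * (a / b) ^ wt u))) = qfacNorm q t a u * ((a / c) ^ wt u *
          ((qfacNorm q t c u)⁻¹ * qfacNorm q t b u)) := by
        rw [show a / c = (b / c) * (a / b) by field_simp, mul_pow]
        ring
      beta_reduce at h1 h2
      rw [hθ] at h1
      have h3 := Submodule.sub_mem _ h1 h2
      rw [sub_sub_sub_cancel_right] at h3
      exact degLT_mono (Nat.lt_succ_iff.1 hu) h3
  exact LinearMap.congr_fun (sub_eq_zero.1 hzero) f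

/-- The compositions with all parts at most `d`. -/
def box (n d : ℕ) : Finset (Fin n → ℕ) := Fintype.piFinset fun _ => Finset.range (d + 1)

lemma mem_box {d : ℕ} {v : Fin n → ℕ} (hv : wt v ≤ d) : v ∈ box n d :=
  Fintype.mem_piFinset.2 fun i => Finset.mem_range.2 <| Nat.lt_succ_iff.2 <|
    (Finset.single_le_sum (fun _ _ => Nat.zero_le _) (Finset.mem_univ i)).trans hv

lemma IsConnection.support_subset {M : (Fin n → ℕ) → MvPolynomial (Fin n) ℂ} {a b : ℂ}
    {cc : (Fin n → ℕ) → (Fin n → ℕ) → ℂ} (hcc : IsConnection q t M a b cc) {u v : Fin n → ℕ}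
    (hv : cc u v ≠ 0) : v ∈ box n (wt u) :=
  mem_box (not_lt.1 fun hlt => hv (hcc.1 u v hlt))

lemma IsConnection.scale_eq {M : (Fin n → ℕ) → MvPolynomial (Fin n) ℂ} {a b : ℂ}
    {cc : (Fin n → ℕ) → (Fin n → ℕ) → ℂ} (hcc : IsConnection q t M a b cc) (hb : b ≠ 0)
    (u : Fin n → ℕ) : scale (a / b) (MM q t M u) = ∑ v ∈ box n (wt u), cc u v • MM q t M v := by
  have h2 : scale a (MM q t M u) = ∑ᶠ v, cc u v • scale b (MM q t M v) := hcc.2 u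
  rw [finsum_eq_sum_of_support_subset (s := box n (wt u))] at h2
  · rw [show a / b = b⁻¹ * a by ring, ← scale_scale, h2, map_sum]
    simp only [map_smul, scale_scale, inv_mul_cancel₀ hb, scale_one]
  · intro v hv
    refine hcc.support_subset fun h0 => hv ?_
    simp only [h0, zero_smul]

lemma Interp.coord_diagOp {B : (Fin n → ℕ) → MvPolynomial (Fin n) ℂ} (h : Generic q t)
    (hB : Interp q t B) (φ : (Fin n → ℕ) → ℂ) (w : Fin n → ℕ) (f : MvPolynomial (Fin n) ℂ) :
    (hB.basis h).coord w (hB.diagOp h φ f) = φ w * (hB.basis h).coord w f := by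
  have : ((hB.basis h).coord w).comp (hB.diagOp h φ) = φ w • (hB.basis h).coord w := by
    refine (hB.basis h).ext fun u => ?_
    rw [LinearMap.comp_apply, LinearMap.smul_apply, hB.basis_apply, hB.diagOp_apply, map_smul,
      ← hB.basis_apply h, Module.Basis.coord_apply, Module.Basis.repr_self, smul_eq_mul,
      smul_eq_mul]
    by_cases huw : u = w
    · rw [huw]
    · simp [huw]
  exact LinearMap.congr_fun this f

lemma IsConnection.coord_scale {M : (Fin n → ℕ) → MvPolynomial (Fin n) ℂ} {a b : ℂ}
    {cc : (Fin n → ℕ) → (Fin n → ℕ) → ℂ} (h : Generic q t) (hB : Interp q t (MM q t M))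
    (hcc : IsConnection q t M a b cc) (hb : b ≠ 0) (u w : Fin n → ℕ) :
    (hB.basis h).coord w (scale (a / b) (MM q t M u)) = cc u w := by
  classical
  rw [hcc.scale_eq hb, map_sum]
  simp only [map_smul, ← hB.basis_apply h, Module.Basis.coord_apply, Module.Basis.repr_self,
    Finsupp.single_apply, smul_eq_mul, mul_ite, mul_one, mul_zero]
  rw [Finset.sum_ite_eq']
  split_ifs with hw
  · rfl
  · exact (not_not.1 fun h0 => hw (hcc.support_subset h0)).symm

end Connection

section Evaluation

variable {m : ℕ} {q t : ℂ} {B : (Fin (m + 1) → ℕ) → MvPolynomial (Fin (m + 1)) ℂ}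

/-- The restriction of a polynomial to the line through the point `y`. -/
def onLine (y : Fin n → ℂ) : MvPolynomial (Fin n) ℂ →ₐ[ℂ] Polynomial ℂ :=
  aeval fun i => Polynomial.C (y i) * Polynomial.X

lemma eval_onLine (y : Fin n → ℂ) (z : ℂ) (f : MvPolynomial (Fin n) ℂ) :
    (onLine y f).eval z = eval (fun i => y i * z) f := by
  induction f using MvPolynomial.induction_on with
  | C a => simp [onLine]
  | add p r hp hr => rw [map_add, map_add, Polynomial.eval_add, hp, hr]
  | mul_X p i hp => rw [map_mul, map_mul, Polynomial.eval_mul, hp, onLine, aeval_X]; simp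

lemma coeff_onLine (y : Fin n → ℂ) (d : ℕ) (f : MvPolynomial (Fin n) ℂ) :
    (onLine y f).coeff d = eval y (homogeneousComponent d f) := by
  induction f using MvPolynomial.induction_on' with
  | add p r hp hr => rw [map_add, map_add, Polynomial.coeff_add, hp, hr, map_add]
  | monomial s a =>
    have h1 : onLine y (monomial s a) =
        Polynomial.C (eval y (monomial s a)) * Polynomial.X ^ s.degree := by
      rw [onLine, aeval_monomial, eval_monomial, Finsupp.prod, Finsupp.prod]
      simp only [mul_pow, Finset.prod_mul_distrib, Finset.prod_pow_eq_pow_sum, map_mul, map_prod,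
        map_pow, ← Polynomial.C_eq_algebraMap, Finsupp.degree_apply, mul_assoc]
    rw [h1, Polynomial.coeff_C_mul, Polynomial.coeff_X_pow]
    split_ifs with hd
    · rw [mul_one, homogeneousComponent_of_mem (n := d) (m := d), if_pos rfl]
      rw [mem_homogeneousSubmodule]
      exact isHomogeneous_monomial a hd.symm
    · rw [mul_zero, homogeneousComponent_of_mem (n := s.degree) (m := d), if_neg hd, map_zero]
      rw [mem_homogeneousSubmodule]
      exact isHomogeneous_monomial a rfl

lemma coeff_onLine_of_mem (y : Fin n → ℂ) {d : ℕ} {f : MvPolynomial (Fin n) ℂ}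
    (hf : f ∈ degLT n d) : (onLine y f).coeff d = 0 := by
  have : homogeneousComponent d f = 0 := by
    ext s
    rw [coeff_homogeneousComponent, coeff_zero]
    split_ifs with hs
    · exact hf s hs.ge
    · rfl
  rw [coeff_onLine, this, map_zero]

lemma onLine_hecke (h : Generic q t) (i : Fin m) (f : MvPolynomial (Fin (m + 1)) ℂ) :
    onLine (spec q t fun _ => 0) (hecke t i f) = onLine (spec q t fun _ => 0) f := by
  refine Polynomial.funext fun z => ?_
  rw [eval_onLine, eval_onLine]
  by_cases hz : z = 0
  · rw [eval_hecke_of_eq_zero t i f (by rw [hz, mul_zero])]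
    simp only [hz, mul_zero, Function.comp_def]
  · refine eval_hecke_of_eq_mul h.t_ne i f ?_ fun heq =>
      spec_castSucc_ne h _ i (mul_right_cancel₀ hz heq)
    rw [spec_castSucc_of_eq h.t_ne _ i rfl, mul_assoc]

lemma onLine_heckeCycle (h : Generic q t) (f : MvPolynomial (Fin (m + 1)) ℂ) :
    onLine (spec q t fun _ => 0) (heckeCycle m t f) = onLine (spec q t fun _ => 0) f := by
  have : ∀ k (hk : k ≤ m) g, onLine (spec q t fun _ => 0) (heckeProd t k hk g) =
      onLine (spec q t fun _ => 0) g := by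
    intro k
    induction k with
    | zero => exact fun _ _ => rfl
    | succ k ih =>
      intro hk g
      rw [heckeProd, LinearMap.comp_apply, ih, onLine_hecke h]
  exact this m le_rfl f

lemma Interp.coeff_onLine_adj_ne_zero (h : Generic q t) (hB : Interp q t B)
    (u : Fin (m + 1) → ℕ) (i : Fin m) (hu : u i.castSucc ≠ u i.succ)
    (hne : (onLine (spec q t fun _ => 0) (B u)).coeff (wt u) ≠ 0) :
    (onLine (spec q t fun _ => 0) (B (u ∘ adj i))).coeff (wt u) ≠ 0 := by
  have hwt : wt (u ∘ adj i) = wt u := wt_comp_perm u _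
  have huadj : u ∘ adj i ≠ u := fun he => hu (by
    have := congrFun he i.castSucc
    simpa [adj] using this.symm)
  have hadj : (u ∘ adj i) ∘ adj i = u := by
    funext k
    simp [adj]
  have hmem := hB.mem_span_of_vanish h {u, u ∘ adj i} (hecke_mem_degLT t i (hB.mem u))
    fun v hv hvu => by
      refine eval_spec_hecke h i v (hB.van u v hv fun he => hvu ⟨by rw [he], by simp [he]⟩)
        (hB.van u _ (by rwa [wt_comp_perm]) fun he => hvu ?_)
      have : v = u ∘ adj i := by
        rw [← he]
        funext k
        simp [adj]
      exact ⟨by rw [this, hwt], by simp [this]⟩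
  have hset : {v | wt v = wt u ∧ v ∈ ({u, u ∘ adj i} : Set (Fin (m + 1) → ℕ))} =
      {u, u ∘ adj i} := by
    ext v
    refine ⟨fun hv => hv.2, fun hv => ⟨?_, hv⟩⟩
    rcases hv with rfl | hv
    · rfl
    · rw [Set.mem_singleton_iff.1 hv, hwt]
  rw [hset, Set.image_pair, Submodule.mem_span_pair] at hmem
  obtain ⟨α, β, hαβ⟩ := hmem
  have hα : α ≠ 1 := by
    rintro rfl
    have hev := eval_hecke t i (B u) (spec q t u)
    rw [← hαβ, map_add, smul_eval, smul_eval, hB.van (u ∘ adj i) u hwt.ge huadj.symm,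
      ← spec_adj q t u i hu, hB.van u (u ∘ adj i) hwt.le huadj] at hev
    have hd := hB.diag u
    have h1 : spec q t u i.castSucc - spec q t u i.succ = (1 - t⁻¹) * spec q t u i.castSucc := by
      apply mul_right_cancel₀ hd
      linear_combination hev
    apply spec_castSucc_ne_mul h u i hu
    have ht := h.t_ne
    field_simp at h1
    linear_combination h1
  intro hz
  have hco := congrArg (fun p => (onLine (spec q t fun _ => 0) p).coeff (wt u)) hαβ
  simp only [onLine_hecke h, map_add, map_smul, Polynomial.coeff_add, Polynomial.coeff_smul, hz,
    smul_eq_mul] at hco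
  exact hα (mul_right_cancel₀ hne (by linear_combination hco))

lemma Interp.coeff_onLine_raise_ne_zero (h : Generic q t) (hB : Interp q t B)
    (w : Fin (m + 1) → ℕ) (hne : (onLine (spec q t fun _ => 0) (B w)).coeff (wt w) ≠ 0) :
    (onLine (spec q t fun _ => 0) (B (raise w))).coeff (wt (raise w)) ≠ 0 := by
  obtain ⟨γ, hγ⟩ := hB.exists_X_zero_mul h w
  have hco := congrArg (fun p => (onLine (spec q t fun _ => 0) p).coeff (wt w + 1)) hγ
  simp only [map_mul, map_smul, map_add, onLine_heckeCycle h, Polynomial.coeff_add,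
    Polynomial.coeff_smul, coeff_onLine_of_mem _ (hB.mem w), zero_add] at hco
  intro hz
  rw [wt_raise] at hz
  rw [hz, smul_zero, smul_zero, onLine, aeval_X, ← onLine, mul_assoc, Polynomial.coeff_C_mul,
    Polynomial.coeff_X_mul] at hco
  exact (mul_ne_zero (spec_ne_zero h _ _) hne) hco

/-- The top homogeneous components of the interpolation polynomials do not vanish at `⟨0⟩`. -/
theorem Interp.coeff_onLine_ne_zero (h : Generic q t) (hB : Interp q t B) (d : ℕ) :
    ∀ u : Fin (m + 1) → ℕ, wt u = d →
      (onLine (spec q t fun _ => 0) (B u)).coeff d ≠ 0 := by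
  induction d with
  | zero =>
    intro u hu
    have hu0 : u = fun _ => 0 := funext fun i =>
      (Finset.sum_eq_zero_iff.1 hu) i (Finset.mem_univ i)
    have hmem := hB.mem u
    rw [hu, mem_degLT_succ, Nat.le_zero, totalDegree_eq_zero_iff_eq_C] at hmem
    have hd := hB.diag u
    rw [hmem, eval_C] at hd
    rw [coeff_onLine, homogeneousComponent_zero, eval_C]
    exact hd
  | succ d ih =>
    have key : ∀ i : Fin (m + 1), ∀ u : Fin (m + 1) → ℕ, wt u = d + 1 → u i ≠ 0 →
        (onLine (spec q t fun _ => 0) (B u)).coeff (d + 1) ≠ 0 := by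
      intro i
      refine Fin.reverseInduction ?_ (fun i ih' => ?_) i
      · intro u hu hl
        obtain ⟨w, rfl⟩ := exists_raise hl
        rw [← hu]
        refine hB.coeff_onLine_raise_ne_zero h w ?_
        have : wt w = d := by rw [wt_raise] at hu; omega
        rw [this]
        exact ih w this
      · intro u hu hi
        by_cases heq : u i.castSucc = u i.succ
        · exact ih' u hu (heq ▸ hi)
        · have hwt : wt (u ∘ adj i) = d + 1 := by rw [wt_comp_perm, hu]
          have := hB.coeff_onLine_adj_ne_zero h (u ∘ adj i) i
            (by simpa [adj] using Ne.symm heq)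
            (by rw [hwt]; exact ih' _ hwt (by simpa [adj] using hi))
          rw [hwt] at this
          have hadj : (u ∘ adj i) ∘ adj i = u := by
            funext k
            simp [adj]
          rwa [hadj] at this
    intro u hu
    obtain ⟨i, hi⟩ : ∃ i, u i ≠ 0 := by
      by_contra! h0
      simp [wt, h0] at hu
    exact key i u hu hi

end Evaluation

section MacdonaldFamily

variable {q t : ℂ} {M : (Fin n → ℕ) → MvPolynomial (Fin n) ℂ}

lemma cp_ne_zero (h : Generic q t) (u : Fin n → ℕ) : cp q t u ≠ 0 := by
  refine Finset.prod_ne_zero_iff.2 fun i _ => Finset.prod_ne_zero_iff.2 fun j hj => ?_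
  have hj' := Finset.mem_range.1 hj
  rw [sub_ne_zero]
  have := h.mul_ne_mul (a := 0) (b := u i - j) (c := 0) (d := leg u i j) (Or.inl (by omega))
  simpa using this

lemma IsInterpFamily.interp (h : Generic q t) (hM : IsInterpFamily q t M) :
    Interp q t (MM q t M) := by
  have hq := h.q_ne
  have ht := h.t_ne
  refine Interp.mk_of_ne_zero h (fun u => ?_) (fun u v hv hne => ?_) fun u => ?_
  · rw [MM, ← smul_eq_C_mul]
    exact Submodule.smul_mem _ _ (mem_degLT_succ.2 (hM u).1)
  · rw [MM, map_mul, (hM u).2.2 v hv hne, mul_zero]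
  · refine mul_ne_zero ?_ fun h0 => ?_
    · rw [Ne, C_eq_zero]
      exact div_ne_zero (mul_ne_zero (pow_ne_zero _ hq) (pow_ne_zero _ ht)) (cp_ne_zero h u)
    · have := (hM u).2.1
      rw [h0, coeff_zero] at this
      exact inv_ne_zero (pow_ne_zero _ hq) this.symm

lemma homogeneousComponent_MM (q t : ℂ) (M : (Fin n → ℕ) → MvPolynomial (Fin n) ℂ)
    (u : Fin n → ℕ) :
    homogeneousComponent (wt u) (MM q t M u) = q ^ nstat' u • EE q t M u := by
  rw [MM, EE, ← smul_eq_C_mul, ← smul_eq_C_mul, map_smul, smul_smul, mul_div_assoc]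

lemma eval_spec_EE_ne_zero {m : ℕ} {M : (Fin (m + 1) → ℕ) → MvPolynomial (Fin (m + 1)) ℂ}
    (h : Generic q t) (hM : IsInterpFamily q t M) (u : Fin (m + 1) → ℕ) :
    eval (spec q t fun _ => 0) (EE q t M u) ≠ 0 := by
  have := (hM.interp h).coeff_onLine_ne_zero h (wt u) u rfl
  rw [coeff_onLine, homogeneousComponent_MM, smul_eval] at this
  exact right_ne_zero_of_mul this

lemma eval_spec0div_EE (q t a : ℂ) (M : (Fin n → ℕ) → MvPolynomial (Fin n) ℂ)
    (u : Fin n → ℕ) : eval (spec0div q t a) (EE q t M u) =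
      eval (spec q t fun _ => 0) (EE q t M u) / a ^ wt u := by
  have hom : (EE q t M u).IsHomogeneous (wt u) := by
    rw [EE]
    simpa using (isHomogeneous_C (Fin n) (t ^ nstat u / cp q t u)).mul
      (homogeneousComponent_isHomogeneous (wt u) (M u))
  have hsc : scale a⁻¹ (EE q t M u) = a⁻¹ ^ wt u • EE q t M u := by
    ext s
    rw [coeff_scale, coeff_smul, smul_eq_mul]
    by_cases hs : coeff s (EE q t M u) = 0
    · rw [hs, mul_zero, mul_zero]
    · rw [show s.degree = wt u from
        (DFunLike.congr_fun Finsupp.degree_eq_weight_one s).trans (hom hs)]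
  have := congrArg (eval (spec q t fun _ => 0)) hsc
  rw [eval_scale, smul_eval] at this
  rw [div_eq_inv_mul, ← inv_pow, ← this]
  congr 2
  funext i
  rw [spec0div, div_eq_inv_mul]

end MacdonaldFamily

/-- **Multiple q-Pfaff–Saalschütz sum** (Theorem 6.6). -/
theorem multiple_q_pfaff_saalschuetz
    (hn : 0 < n) (q t : ℂ) (hq0 : q ≠ 0) (ht : t ≠ 0)
    (hqt : ∀ i j : ℤ, ¬(i = 0 ∧ j = 0) → q ^ i * t ^ j ≠ 1)
    (M : (Fin n → ℕ) → MvPolynomial (Fin n) ℂ) (hM : IsInterpFamily q t M)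
    (a b c : ℂ) (ha : a ≠ 0) (hb : b ≠ 0) (hc : c ≠ 0)
    (u w : Fin n → ℕ)
    (hcv : ∀ v : Fin n → ℕ, qfac q t c v ≠ 0) (hbw : qfac q t b w ≠ 0)
    (ccab ccbc ccac : (Fin n → ℕ) → (Fin n → ℕ) → ℂ)
    (h1 : IsConnection q t M a b ccab) (h2 : IsConnection q t M b c ccbc)
    (h3 : IsConnection q t M a c ccac) :
    ∑ᶠ v : Fin n → ℕ, qfac q t a v / qfac q t c v *
        skew q t M a b ccab u v * skew q t M b c ccbc v w =
      qfac q t a w * qfac q t b u / (qfac q t b w * qfac q t c u) *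
        skew q t M a c ccac u w := by
  obtain ⟨m, rfl⟩ : ∃ m, n = m + 1 := ⟨n - 1, by omega⟩
  have h : Generic q t := ⟨hq0, ht, hqt⟩
  have hB := hM.interp h
  have hfac := congrArg ((hB.basis h).coord w) (hB.factorization h ha hb hc hcv (MM q t M u))
  rw [hB.coord_diagOp, hB.coord_diagOp, h1.scale_eq hb, hB.diagOp_apply] at hfac
  simp only [map_sum, map_smul, hB.diagOp_apply, h2.coord_scale h hB hc,
    h3.coord_scale h hB hc, smul_eq_mul] at hfac
  have hE := eval_spec_EE_ne_zero h hM
  rw [finsum_eq_sum_of_support_subset (s := box (m + 1) (wt u))]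
  · set e := fun v => eval (spec q t fun _ => 0) (EE q t M v) with he
    have hterm : ∀ v, qfac q t a v / qfac q t c v * skew q t M a b ccab u v *
        skew q t M b c ccbc v w = e w * b ^ wt u / (e u * b ^ wt w) *
          (ccab u v * (qfacNorm q t a v * ((qfacNorm q t c v)⁻¹ * ccbc v w))) := by
      intro v
      have hv : e v ≠ 0 := hE v
      have hu : e u ≠ 0 := hE u
      have hcv' := hcv v
      simp only [skew, eval_spec0div_EE, qfacNorm]
      change _ * (e v / _ / (e u / _) * _) * (e w / _ / (e v / _) * _) = _
      field_simp
    rw [Finset.sum_congr rfl fun v _ => hterm v, ← Finset.mul_sum]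
    set S := ∑ v ∈ box (m + 1) (wt u),
      ccab u v * (qfacNorm q t a v * ((qfacNorm q t c v)⁻¹ * ccbc v w)) with hS
    have hu : e u ≠ 0 := hE u
    have hcu := hcv u
    simp only [skew, eval_spec0div_EE]
    change _ = _ * (e w / _ / (e u / _) * _)
    simp only [qfacNorm] at hfac
    field_simp at hfac ⊢
    linear_combination e w * hfac
  · intro v hv
    refine h1.support_subset fun h0 => hv ?_
    simp only [skew, h0, mul_zero, zero_mul]

end LRW
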